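/- arXiv:0901.4800 — 3 statements merged into one kernel-verified Lean document; each statement's English description precedes it below -/
import Mathlib

section
/- Let f and g be C^∞ functions from ℝ∖{0} to ℝ, and define φ on (ℝ∖{0})² by φ(x,y) = (f(x)g(y) − g(x)f(y))/(x − y) for x ≠ y and φ(x,x) = f′(x)g(x) − g′(x)f(x). Then for all p,q ∈ ℕ and all x, y of the same sign (both positive or both negative): ∂^{p+q}φ/∂x^p∂y^q (x,y) = ∑_{k=0}^q binom(q,k) [ g^{(q−k)}(y) ∫₀¹ f^{(k+p+1)}(y + θ(x−y)) θ^p (1−θ)^k dθ − f^{(q−k)}(y) ∫₀¹ g^{(k+p+1)}(y + θ(x−y)) θ^p (1−θ)^k dθ ]. -/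
noncomputable section

open Complex MeasureTheory Filter Set

/-- Rising Pochhammer symbol `(x)_n = x(x+1)⋯(x+n−1)`. -/
def poch (x : ℂ) (n : ℕ) : ℂ := ∏ i ∈ Finset.range n, (x + i)

/-- Confluent hypergeometric series `₁F₁[r, q; z]`. -/
def oneF1 (r q z : ℂ) : ℂ := ∑' n : ℕ, poch r n / (poch q n * n.factorial) * z ^ n

/-- Terminating Gauss hypergeometric series `₂F₁[−m, b, c; z]`. -/
def twoF1neg (m : ℕ) (b c z : ℂ) : ℂ :=
  ∑ k ∈ Finset.range (m + 1),
    poch (-(m : ℂ)) k * poch b k / (poch c k * (k.factorial : ℂ)) * z ^ k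

/-- The common prefactor `|2/x|^{Re s} e^{−i/x + π Im(s) Sgn(x)/2}`. -/
def prefac (s : ℂ) (x : ℝ) : ℂ :=
  ((|2 / x| ^ s.re : ℝ) : ℂ) *
    Complex.exp (-Complex.I / (x : ℂ) + ((Real.pi * s.im * Real.sign x / 2 : ℝ) : ℂ))

/-- `P̃(x) = |2/x|^{Re s} e^{−i/x + π Im(s) Sgn(x)/2} ₁F₁[s, 2Re(s)+1; 2i/x]`. -/
def Ptilde (s : ℂ) (x : ℝ) : ℂ :=
  prefac s x * oneF1 s ((2 * s.re + 1 : ℝ) : ℂ) (2 * Complex.I / (x : ℂ))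

/-- `Q(x) = (2/x)|2/x|^{Re s} e^{−i/x + π Im(s) Sgn(x)/2} ₁F₁[s+1, 2Re(s)+2; 2i/x]`. -/
def Qfun (s : ℂ) (x : ℝ) : ℂ :=
  (2 / (x : ℂ)) * prefac s x * oneF1 (s + 1) ((2 * s.re + 2 : ℝ) : ℂ) (2 * Complex.I / (x : ℂ))

/-- The constant in front of the limiting kernel `K_∞`. -/
def cinf (s : ℂ) : ℂ :=
  (1 / (2 * (Real.pi : ℂ))) *
    (Complex.Gamma (s + 1) * Complex.Gamma ((starRingEnd ℂ) s + 1) /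
      (Complex.Gamma ((2 * s.re + 1 : ℝ) : ℂ) * Complex.Gamma ((2 * s.re + 2 : ℝ) : ℂ)))

/-- The limiting kernel `K_∞`, as a complex number (it is in fact real). -/
def KinfC (s : ℂ) (x y : ℝ) : ℂ :=
  if x = y then cinf s * (deriv (Ptilde s) x * Qfun s x - deriv (Qfun s) x * Ptilde s x)
  else cinf s * (Ptilde s x * Qfun s y - Qfun s x * Ptilde s y) / ((x : ℂ) - (y : ℂ))

/-- The limiting kernel `K_∞` (real-valued). -/
def Kinf (s : ℂ) (x y : ℝ) : ℝ := (KinfC s x y).re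

/-- The generalized Cauchy weight `w_H` on `ℝ`. -/
def wH (s : ℂ) (N : ℕ) (x : ℝ) : ℝ :=
  (1 + x ^ 2) ^ (-s.re - (N : ℝ)) * Real.exp (2 * s.im * Complex.arg (1 + Complex.I * x))

/-- The polynomial `p_{N−1}`. -/
def pPrev (s : ℂ) (N : ℕ) (x : ℝ) : ℂ :=
  ((x : ℂ) - Complex.I) ^ (N - 1) *
    twoF1neg (N - 1) (s + 1) ((2 * s.re + 2 : ℝ) : ℂ) (2 / (1 + Complex.I * (x : ℂ)))

/-- The polynomial `p̃_N`. -/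
def pTil (s : ℂ) (N : ℕ) (x : ℝ) : ℂ :=
  ((x : ℂ) - Complex.I) ^ N *
    twoF1neg N s ((2 * s.re + 1 : ℝ) : ℂ) (2 / (1 + Complex.I * (x : ℂ)))

/-- The constant `C_{N,s}`. -/
def CNs (s : ℂ) (N : ℕ) : ℂ :=
  (((2 : ℝ) ^ (2 * s.re) / Real.pi : ℝ) : ℂ) *
    (Complex.Gamma ((2 * s.re + N + 1 : ℝ) : ℂ) * Complex.Gamma (s + 1) *
        Complex.Gamma ((starRingEnd ℂ) s + 1) /
      (Complex.Gamma (N : ℂ) * Complex.Gamma ((2 * s.re + 1 : ℝ) : ℂ) *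
        Complex.Gamma ((2 * s.re + 2 : ℝ) : ℂ)))

def phiN (s : ℂ) (N : ℕ) (x : ℝ) : ℂ := pTil s N x * (Real.sqrt (wH s N x) : ℂ)

def psiN (s : ℂ) (N : ℕ) (x : ℝ) : ℂ := pPrev s N x * (Real.sqrt (wH s N x) : ℂ)

/-- The finite-`N` kernel `K_N` (complex form; extended to the diagonal by continuity,
i.e. by the Bernoulli–l'Hôpital expression). -/
def KNC (s : ℂ) (N : ℕ) (x y : ℝ) : ℂ :=
  if x = y then CNs s N * (deriv (phiN s N) x * psiN s N x - deriv (psiN s N) x * phiN s N x)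
  else CNs s N * (phiN s N x * psiN s N y - psiN s N x * phiN s N y) / ((x : ℂ) - (y : ℂ))

/-- The finite-`N` kernel `K_N` (real-valued). -/
def KN (s : ℂ) (N : ℕ) (x y : ℝ) : ℝ := (KNC s N x y).re

/-- The rescaled kernel `K_[N](x,y) = N · K_N(Nx, Ny)`. -/
def Kscaled (s : ℂ) (N : ℕ) (x y : ℝ) : ℝ := N * KN s N (N * x) (N * y)

/-- `P̃_N`. -/
def PtildeN (s : ℂ) (N : ℕ) (x : ℝ) : ℂ :=
  (((2 : ℝ) ^ s.re : ℝ) : ℂ) *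
    (Real.sqrt (Real.Gamma (2 * s.re + N + 1) / (N * Real.Gamma N)) : ℂ) *
    pTil s N (N * x) * (Real.sqrt (wH s N (N * x)) : ℂ)

/-- `Q_N`. -/
def QN (s : ℂ) (N : ℕ) (x : ℝ) : ℂ :=
  (((2 : ℝ) ^ (s.re + 1) : ℝ) : ℂ) *
    (Real.sqrt (N * Real.Gamma (2 * s.re + N + 1) / Real.Gamma N) : ℂ) *
    pPrev s N (N * x) * (Real.sqrt (wH s N (N * x)) : ℂ)

/-- `k`-point correlation function of a kernel. -/
def rhoK (K : ℝ → ℝ → ℝ) (k : ℕ) (x : Fin k → ℝ) : ℝ :=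
  Matrix.det (Matrix.of fun i j => K (x i) (x j))

/-- The Fredholm determinant of a kernel restricted to `(t,∞)²`. -/
def fredholmDet (K : ℝ → ℝ → ℝ) (t : ℝ) : ℝ :=
  1 + ∑' k : ℕ, ((-1 : ℝ) ^ (k + 1) / (k + 1).factorial) *
    ∫ x : Fin (k + 1) → ℝ in Set.univ.pi fun _ => Set.Ioi t, rhoK K (k + 1) x

/-- Mixed partial derivative `∂^{p+q}K/∂x^p∂y^q`. -/
def pderiv₂ (K : ℝ → ℝ → ℝ) (p q : ℕ) (x y : ℝ) : ℝ :=
  iteratedDeriv p (fun x' => iteratedDeriv q (fun y' => K x' y') y) x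

/-- `F_{n,h,a}(x) = ₂F₁[−n, h, a; 2/(1+ix)]` (a terminating series). -/
def Fnha (n : ℕ) (h : ℂ) (a : ℝ) (x : ℝ) : ℂ :=
  ∑' k : ℕ, poch (-(n : ℂ)) k * poch h k / (poch (a : ℂ) k * (k.factorial : ℂ)) *
    (2 / (1 + Complex.I * (x : ℂ))) ^ k

/-- `θ(τ) = τ (d/dτ) log F(τ⁻¹)`. -/
def thetaOf (F : ℝ → ℝ) (τ : ℝ) : ℝ := τ * deriv (fun u => Real.log (F u⁻¹)) τ

/-- Squared Vandermonde determinant `∏_{j<k} (x_j − x_k)²`. -/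
def vandSq (N : ℕ) (x : Fin N → ℝ) : ℝ :=
  ∏ p ∈ Finset.univ.filter fun p : Fin N × Fin N => p.1 < p.2, (x p.1 - x p.2) ^ 2

/-- `φ(x,y) = (f(x)g(y) − g(x)f(y))/(x−y)`, extended to the diagonal. -/
def phiFG (f g : ℝ → ℝ) (x y : ℝ) : ℝ :=
  if x = y then deriv f x * g x - deriv g x * f x else (f x * g y - g x * f y) / (x - y)

open scoped Topology Interval

/-- The segment integral `∫₀¹ h(y + θ(x − y)) θ^p (1 − θ)^k dθ`. -/
def segmentIntegral (h : ℝ → ℝ) (p k : ℕ) (x y : ℝ) : ℝ :=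
  ∫ θ in (0 : ℝ)..1, h (y + θ * (x - y)) * θ ^ p * (1 - θ) ^ k

theorem eqOn_iteratedDeriv_of_hasDerivAt_succ {S : Set ℝ} (hS : IsOpen S) {F : ℕ → ℝ → ℝ}
    (hF : ∀ n, ∀ x ∈ S, HasDerivAt (F n) (F (n + 1) x) x) (n : ℕ) :
    EqOn (iteratedDeriv n (F 0)) (F n) S := by
  induction n with
  | zero => simp [EqOn]
  | succ n ih =>
    intro x hx
    rw [iteratedDeriv_succ, (ih.eventuallyEq_of_mem (hS.mem_nhds hx)).deriv_eq]
    exact (hF n x hx).deriv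

theorem contDiffOn_of_hasDerivAt_succ {S : Set ℝ} (hS : IsOpen S) {F : ℕ → ℝ → ℝ}
    (hF : ∀ n, ∀ x ∈ S, HasDerivAt (F n) (F (n + 1) x) x) :
    ContDiffOn ℝ (⊤ : ℕ∞) (F 0) S := by
  refine contDiffOn_of_differentiableOn_deriv fun m _ => ?_
  have h : EqOn (iteratedDerivWithin m (F 0) S) (F m) S :=
    (iteratedDerivWithin_of_isOpen hS).trans (eqOn_iteratedDeriv_of_hasDerivAt_succ hS hF m)
  exact DifferentiableOn.congr
    (fun x hx => (hF m x hx).differentiableAt.differentiableWithinAt) h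

theorem ContDiffOn.hasDerivAt_iteratedDeriv {S : Set ℝ} (hS : IsOpen S) {f : ℝ → ℝ}
    (hf : ContDiffOn ℝ (⊤ : ℕ∞) f S) (n : ℕ) {x : ℝ} (hx : x ∈ S) :
    HasDerivAt (iteratedDeriv n f) (iteratedDeriv (n + 1) f x) x := by
  rw [iteratedDeriv_succ]
  refine DifferentiableAt.hasDerivAt ?_
  have h := (hf.differentiableOn_iteratedDerivWithin (m := n)
    (by exact_mod_cast ENat.natCast_lt_top n) hS.uniqueDiffOn).differentiableAt (hS.mem_nhds hx)
  exact h.congr_of_eventuallyEq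
    ((iteratedDerivWithin_of_isOpen hS).symm.eventuallyEq_of_mem (hS.mem_nhds hx))

/-- Differentiation under the integral sign for an integrand composed with an affine map. -/
theorem hasDerivAt_integral_comp_affine {S T : Set ℝ} (hT : IsOpen T)
    {h h' u v w : ℝ → ℝ} (hh : ∀ z ∈ S, HasDerivAt h (h' z) z) (hh' : ContinuousOn h' S)
    (hu : Continuous u) (hv : Continuous v) (hw : Continuous w)
    (hmem : ∀ x ∈ T, ∀ θ ∈ Icc (0 : ℝ) 1, u θ * x + v θ ∈ S) {x₀ : ℝ} (hx₀ : x₀ ∈ T) :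
    HasDerivAt (fun x => ∫ θ in (0 : ℝ)..1, h (u θ * x + v θ) * w θ)
      (∫ θ in (0 : ℝ)..1, h' (u θ * x₀ + v θ) * (u θ * w θ)) x₀ := by
  obtain ⟨ε, hε, hball⟩ := Metric.nhds_basis_closedBall.mem_iff.1 (hT.mem_nhds hx₀)
  have hcont : ContinuousOn h S := fun z hz => (hh z hz).continuousAt.continuousWithinAt
  have hsub : Ι (0 : ℝ) 1 ⊆ Icc 0 1 := by
    rw [uIoc_of_le zero_le_one]; exact Ioc_subset_Icc_self
  have hc : ∀ x ∈ T, ContinuousOn (fun θ => h (u θ * x + v θ) * w θ) (Icc 0 1) := fun x hx =>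
    (hcont.comp (by fun_prop) (hmem x hx)).mul hw.continuousOn
  have hc' : ContinuousOn (fun z : ℝ × ℝ => h' (u z.2 * z.1 + v z.2) * (u z.2 * w z.2))
      (Metric.closedBall x₀ ε ×ˢ Icc (0 : ℝ) 1) :=
    (hh'.comp (by fun_prop) fun z hz => hmem z.1 (hball hz.1) z.2 hz.2).mul (by fun_prop)
  obtain ⟨C, hC⟩ := ((isCompact_closedBall x₀ ε).prod isCompact_Icc).exists_bound_of_continuousOn hc'
  have hc₀ : ContinuousOn (fun θ => h' (u θ * x₀ + v θ) * (u θ * w θ)) (Icc 0 1) :=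
    (hh'.comp (by fun_prop) (hmem x₀ hx₀)).mul (by fun_prop)
  refine (intervalIntegral.hasDerivAt_integral_of_dominated_loc_of_deriv_le
    (F := fun x θ => h (u θ * x + v θ) * w θ)
    (F' := fun x θ => h' (u θ * x + v θ) * (u θ * w θ)) (bound := fun _ => C)
    (Metric.closedBall_mem_nhds x₀ hε) ?_ ?_ ?_ ?_ intervalIntegrable_const ?_).2
  · filter_upwards [hT.mem_nhds hx₀] with x hx
    exact ((hc x hx).mono hsub).aestronglyMeasurable measurableSet_uIoc
  · exact (hc x₀ hx₀).intervalIntegrable_of_Icc zero_le_one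
  · exact (hc₀.mono hsub).aestronglyMeasurable measurableSet_uIoc
  · exact .of_forall fun θ hθ x hx => hC (x, θ) ⟨hx, hsub hθ⟩
  · refine .of_forall fun θ hθ x hx => ?_
    have h₁ : HasDerivAt (fun x => u θ * x + v θ) (u θ) x := by
      simpa using ((hasDerivAt_id x).const_mul (u θ)).add_const (v θ)
    have h₂ := ((hh _ (hmem x (hball hx) θ (hsub hθ))).comp x h₁).mul_const (w θ)
    exact h₂.congr_deriv (by ring)

theorem Convex.add_mul_sub_mem {S : Set ℝ} (hS : Convex ℝ S) {x y θ : ℝ} (hx : x ∈ S)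
    (hy : y ∈ S) (hθ : θ ∈ Icc (0 : ℝ) 1) : y + θ * (x - y) ∈ S := by
  simpa using hS.add_smul_sub_mem hy hx hθ

theorem hasDerivAt_segmentIntegral_left {S : Set ℝ} (hS : IsOpen S) (hconv : Convex ℝ S)
    {h h' : ℝ → ℝ} (hh : ∀ z ∈ S, HasDerivAt h (h' z) z) (hh' : ContinuousOn h' S) (p k : ℕ)
    {x y : ℝ} (hx : x ∈ S) (hy : y ∈ S) :
    HasDerivAt (fun x => segmentIntegral h p k x y) (segmentIntegral h' (p + 1) k x y) x := by
  have key := hasDerivAt_integral_comp_affine hS hh hh' (u := fun θ => θ)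
    (v := fun θ => y - θ * y) (w := fun θ => θ ^ p * (1 - θ) ^ k)
    (by fun_prop) (by fun_prop) (by fun_prop)
    (fun x hx θ hθ => by
      convert hconv.add_mul_sub_mem hx hy hθ using 1; ring) hx
  have e : ∀ x θ : ℝ, y + θ * (x - y) = θ * x + (y - θ * y) := fun x θ => by ring
  simp only [segmentIntegral, e, mul_assoc]
  exact key.congr_deriv (intervalIntegral.integral_congr fun θ _ => by ring)

theorem hasDerivAt_segmentIntegral_right {S : Set ℝ} (hS : IsOpen S) (hconv : Convex ℝ S)
    {h h' : ℝ → ℝ} (hh : ∀ z ∈ S, HasDerivAt h (h' z) z) (hh' : ContinuousOn h' S) (p k : ℕ)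
    {x y : ℝ} (hx : x ∈ S) (hy : y ∈ S) :
    HasDerivAt (fun y => segmentIntegral h p k x y) (segmentIntegral h' p (k + 1) x y) y := by
  have key := hasDerivAt_integral_comp_affine hS hh hh' (u := fun θ => 1 - θ)
    (v := fun θ => θ * x) (w := fun θ => θ ^ p * (1 - θ) ^ k)
    (by fun_prop) (by fun_prop) (by fun_prop)
    (fun y hy θ hθ => by
      convert hconv.add_mul_sub_mem hx hy hθ using 1; ring) hy
  have e : ∀ y θ : ℝ, y + θ * (x - y) = (1 - θ) * y + θ * x := fun y θ => by ring
  simp only [segmentIntegral, e, mul_assoc]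
  exact key.congr_deriv (intervalIntegral.integral_congr fun θ _ => by ring)

section Smooth

variable {S : Set ℝ} {f g : ℝ → ℝ}

theorem ContDiffOn.continuousOn_iteratedDeriv (hS : IsOpen S)
    (hf : ContDiffOn ℝ (⊤ : ℕ∞) f S) (n : ℕ) : ContinuousOn (iteratedDeriv n f) S :=
  fun _ hz => (hf.hasDerivAt_iteratedDeriv hS n hz).continuousAt.continuousWithinAt

theorem sub_mul_segmentIntegral_deriv (hS : IsOpen S) (hconv : Convex ℝ S)
    (hf : ContDiffOn ℝ (⊤ : ℕ∞) f S) {x y : ℝ} (hx : x ∈ S) (hy : y ∈ S) :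
    (x - y) * segmentIntegral (iteratedDeriv 1 f) 0 0 x y = f x - f y := by
  have key := intervalIntegral.integral_unitInterval_deriv_eq_sub (𝕜 := ℝ) (f := f)
    (f' := iteratedDeriv 1 f) (z₀ := y) (z₁ := x - y)
    ((hf.continuousOn_iteratedDeriv hS 1).comp (by fun_prop)
      fun θ hθ => hconv.add_mul_sub_mem hx hy hθ)
    (fun θ hθ => by
      simpa using hf.hasDerivAt_iteratedDeriv hS 0 (hconv.add_mul_sub_mem hx hy hθ))
  simpa [segmentIntegral] using key

theorem phiFG_eq_segmentIntegral (hS : IsOpen S) (hconv : Convex ℝ S)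
    (hf : ContDiffOn ℝ (⊤ : ℕ∞) f S) (hg : ContDiffOn ℝ (⊤ : ℕ∞) g S)
    {x y : ℝ} (hx : x ∈ S) (hy : y ∈ S) :
    phiFG f g x y = segmentIntegral (iteratedDeriv 1 f) 0 0 x y * g y -
      segmentIntegral (iteratedDeriv 1 g) 0 0 x y * f y := by
  unfold phiFG
  split_ifs with hxy
  · subst hxy
    simp [segmentIntegral]
  · rw [div_eq_iff (sub_ne_zero.2 hxy)]
    linear_combination (-g y) * sub_mul_segmentIntegral_deriv hS hconv hf hx hy +
      f y * sub_mul_segmentIntegral_deriv hS hconv hg hx hy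

theorem hasDerivAt_segmentIntegral_iteratedDeriv_left (hS : IsOpen S) (hconv : Convex ℝ S)
    (hf : ContDiffOn ℝ (⊤ : ℕ∞) f S) (n p k : ℕ) {x y : ℝ} (hx : x ∈ S) (hy : y ∈ S) :
    HasDerivAt (fun x => segmentIntegral (iteratedDeriv n f) p k x y)
      (segmentIntegral (iteratedDeriv (n + 1) f) (p + 1) k x y) x :=
  hasDerivAt_segmentIntegral_left hS hconv (fun _ hz => hf.hasDerivAt_iteratedDeriv hS n hz)
    (hf.continuousOn_iteratedDeriv hS (n + 1)) p k hx hy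

theorem hasDerivAt_segmentIntegral_iteratedDeriv_right (hS : IsOpen S) (hconv : Convex ℝ S)
    (hf : ContDiffOn ℝ (⊤ : ℕ∞) f S) (n p k : ℕ) {x y : ℝ} (hx : x ∈ S) (hy : y ∈ S) :
    HasDerivAt (fun y => segmentIntegral (iteratedDeriv n f) p k x y)
      (segmentIntegral (iteratedDeriv (n + 1) f) p (k + 1) x y) y :=
  hasDerivAt_segmentIntegral_right hS hconv (fun _ hz => hf.hasDerivAt_iteratedDeriv hS n hz)
    (hf.continuousOn_iteratedDeriv hS (n + 1)) p k hx hy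

theorem contDiffAt_segmentIntegral_right (hS : IsOpen S) (hconv : Convex ℝ S)
    (hf : ContDiffOn ℝ (⊤ : ℕ∞) f S) {x y : ℝ} (hx : x ∈ S) (hy : y ∈ S) :
    ContDiffAt ℝ (⊤ : ℕ∞) (fun y => segmentIntegral (iteratedDeriv 1 f) 0 0 x y) y :=
  (contDiffOn_of_hasDerivAt_succ hS
    (F := fun k y => segmentIntegral (iteratedDeriv (k + 1) f) 0 k x y)
    (fun k _ hy => hasDerivAt_segmentIntegral_iteratedDeriv_right hS hconv hf (k + 1) 0 k hx hy)
    ).contDiffAt (hS.mem_nhds hy)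

theorem iteratedDeriv_segmentIntegral_right (hS : IsOpen S) (hconv : Convex ℝ S)
    (hf : ContDiffOn ℝ (⊤ : ℕ∞) f S) (k : ℕ) {x y : ℝ} (hx : x ∈ S) (hy : y ∈ S) :
    iteratedDeriv k (fun y => segmentIntegral (iteratedDeriv 1 f) 0 0 x y) y =
      segmentIntegral (iteratedDeriv (k + 1) f) 0 k x y :=
  eqOn_iteratedDeriv_of_hasDerivAt_succ hS
    (F := fun k y => segmentIntegral (iteratedDeriv (k + 1) f) 0 k x y)
    (fun k _ hy => hasDerivAt_segmentIntegral_iteratedDeriv_right hS hconv hf (k + 1) 0 k hx hy)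
    k hy

theorem iteratedDeriv_segmentIntegral_mul (hS : IsOpen S) (hconv : Convex ℝ S)
    (hf : ContDiffOn ℝ (⊤ : ℕ∞) f S) (hg : ContDiffOn ℝ (⊤ : ℕ∞) g S) (q : ℕ)
    {x y : ℝ} (hx : x ∈ S) (hy : y ∈ S) :
    iteratedDeriv q ((fun y => segmentIntegral (iteratedDeriv 1 f) 0 0 x y) * g) y =
      ∑ k ∈ Finset.range (q + 1), (q.choose k : ℝ) *
        segmentIntegral (iteratedDeriv (k + 1) f) 0 k x y * iteratedDeriv (q - k) g y := by
  have hle : (q : WithTop ℕ∞) ≤ ((⊤ : ℕ∞) : WithTop ℕ∞) := by exact_mod_cast le_top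
  rw [iteratedDeriv_mul ((contDiffAt_segmentIntegral_right hS hconv hf hx hy).of_le hle)
    ((hg.contDiffAt (hS.mem_nhds hy)).of_le hle)]
  exact Finset.sum_congr rfl fun k _ => by
    rw [iteratedDeriv_segmentIntegral_right hS hconv hf k hx hy]

theorem iteratedDeriv_phiFG_right (hS : IsOpen S) (hconv : Convex ℝ S)
    (hf : ContDiffOn ℝ (⊤ : ℕ∞) f S) (hg : ContDiffOn ℝ (⊤ : ℕ∞) g S) (q : ℕ)
    {x y : ℝ} (hx : x ∈ S) (hy : y ∈ S) :
    iteratedDeriv q (fun y => phiFG f g x y) y =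
      ∑ k ∈ Finset.range (q + 1), (q.choose k : ℝ) *
        (iteratedDeriv (q - k) g y * segmentIntegral (iteratedDeriv (k + 1) f) 0 k x y -
          iteratedDeriv (q - k) f y * segmentIntegral (iteratedDeriv (k + 1) g) 0 k x y) := by
  have heq : EqOn (fun y => phiFG f g x y)
      ((fun y => segmentIntegral (iteratedDeriv 1 f) 0 0 x y) * g -
        (fun y => segmentIntegral (iteratedDeriv 1 g) 0 0 x y) * f) S :=
    fun y hy => phiFG_eq_segmentIntegral hS hconv hf hg hx hy
  have hle : (q : WithTop ℕ∞) ≤ ((⊤ : ℕ∞) : WithTop ℕ∞) := by exact_mod_cast le_top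
  rw [heq.iteratedDeriv_of_isOpen hS q hy, iteratedDeriv_sub
      (f := (fun y => segmentIntegral (iteratedDeriv 1 f) 0 0 x y) * g)
      (g := (fun y => segmentIntegral (iteratedDeriv 1 g) 0 0 x y) * f)
      (((contDiffAt_segmentIntegral_right hS hconv hf hx hy).mul
        (hg.contDiffAt (hS.mem_nhds hy))).of_le hle)
      (((contDiffAt_segmentIntegral_right hS hconv hg hx hy).mul
        (hf.contDiffAt (hS.mem_nhds hy))).of_le hle),
    iteratedDeriv_segmentIntegral_mul hS hconv hf hg q hx hy,
    iteratedDeriv_segmentIntegral_mul hS hconv hg hf q hx hy, ← Finset.sum_sub_distrib]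
  exact Finset.sum_congr rfl fun k _ => by ring

theorem pderiv₂_phiFG (hS : IsOpen S) (hconv : Convex ℝ S)
    (hf : ContDiffOn ℝ (⊤ : ℕ∞) f S) (hg : ContDiffOn ℝ (⊤ : ℕ∞) g S) (p q : ℕ)
    {x y : ℝ} (hx : x ∈ S) (hy : y ∈ S) :
    pderiv₂ (phiFG f g) p q x y =
      ∑ k ∈ Finset.range (q + 1), (q.choose k : ℝ) *
        (iteratedDeriv (q - k) g y * segmentIntegral (iteratedDeriv (k + p + 1) f) p k x y -
          iteratedDeriv (q - k) f y * segmentIntegral (iteratedDeriv (k + p + 1) g) p k x y) := by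
  have heq : EqOn (fun x => iteratedDeriv q (fun y => phiFG f g x y) y) _ S :=
    fun x hx => iteratedDeriv_phiFG_right hS hconv hf hg q hx hy
  refine (heq.iteratedDeriv_of_isOpen hS p hx).trans
    (eqOn_iteratedDeriv_of_hasDerivAt_succ hS (F := fun p x =>
      ∑ k ∈ Finset.range (q + 1), (q.choose k : ℝ) *
        (iteratedDeriv (q - k) g y * segmentIntegral (iteratedDeriv (k + p + 1) f) p k x y -
          iteratedDeriv (q - k) f y * segmentIntegral (iteratedDeriv (k + p + 1) g) p k x y))
      (fun p x hx => HasDerivAt.fun_sum fun k _ => ?_) p hx)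
  exact (((hasDerivAt_segmentIntegral_iteratedDeriv_left hS hconv hf (k + p + 1) p k hx
    hy).const_mul _).sub ((hasDerivAt_segmentIntegral_iteratedDeriv_left hS hconv hg
    (k + p + 1) p k hx hy).const_mul _)).const_mul _

end Smooth

/-- For `f, g` `C^∞` on `ℝ∖{0}` and `φ` as above, for `x, y` of the same
sign: `∂^{p+q}φ/∂x^p∂y^q (x,y) = ∑_{k≤q} C_q^k [g^{(q−k)}(y) ∫₀¹ f^{(k+p+1)}(y+θ(x−y)) θ^p
(1−θ)^k dθ − f^{(q−k)}(y) ∫₀¹ g^{(k+p+1)}(y+θ(x−y)) θ^p (1−θ)^k dθ]`. -/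
theorem phiFG_same_sign_formula (f g : ℝ → ℝ)
    (hf : ContDiffOn ℝ (⊤ : ℕ∞) f {0}ᶜ) (hg : ContDiffOn ℝ (⊤ : ℕ∞) g {0}ᶜ) :
    ∀ p q : ℕ, ∀ x y : ℝ, 0 < x * y →
      pderiv₂ (phiFG f g) p q x y =
        ∑ k ∈ Finset.range (q + 1), (q.choose k : ℝ) *
          (iteratedDeriv (q - k) g y *
              (∫ θ in (0 : ℝ)..1,
                iteratedDeriv (k + p + 1) f (y + θ * (x - y)) * θ ^ p * (1 - θ) ^ k) -
            iteratedDeriv (q - k) f y *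
              ∫ θ in (0 : ℝ)..1,
                iteratedDeriv (k + p + 1) g (y + θ * (x - y)) * θ ^ p * (1 - θ) ^ k) := by
  intro p q x y hxy
  rcases pos_and_pos_or_neg_and_neg_of_mul_pos hxy with ⟨hx, hy⟩ | ⟨hx, hy⟩
  · have hsub : Ioi (0 : ℝ) ⊆ {0}ᶜ := fun z hz => ne_of_gt hz
    exact pderiv₂_phiFG isOpen_Ioi (convex_Ioi 0) (hf.mono hsub) (hg.mono hsub) p q hx hy
  · have hsub : Iio (0 : ℝ) ⊆ {0}ᶜ := fun z hz => ne_of_lt hz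
    exact pderiv₂_phiFG isOpen_Iio (convex_Iio 0) (hf.mono hsub) (hg.mono hsub) p q hx hy
end
end

section
/- Let s ∈ ℂ with Re(s) > −1/2. The kernels K_[N] (for each N ≥ 1) and K_∞ are C^∞ on (ℝ∖{0})², and for all p,q ∈ ℕ and all x,y ∈ ℝ∖{0}: (Sgn(xy))^N · ∂^{p+q}K_[N]/∂x^p∂y^q (x,y) → ∂^{p+q}K_∞/∂x^p∂y^q (x,y) as N → ∞. Moreover, for every x₀ > 0 and all p,q ∈ ℕ there is a constant C(x₀,s,p,q) such that |∂^{p+q}K_[N]/∂x^p∂y^q (x,y)| ≤ C(x₀,s,p,q)/(|x|^{Re(s)+p+1} |y|^{Re(s)+q+1}) for all N ≥ 1 and all |x|, |y| ≥ x₀. -/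
noncomputable section

open Complex MeasureTheory Filter Set

/-- A sequence of smooth functions on `ℝ`, together with its limit (the value at `none`), all of
whose derivatives converge pointwise and are bounded on compact sets uniformly along the sequence. -/
structure SmoothFam (f : Option ℕ → ℝ → ℂ) : Prop where
  contDiff : ∀ n, ContDiff ℝ (⊤ : ℕ∞) (f n)
  tendsto : ∀ k u, Tendsto (fun N => iteratedDeriv k (f (some N)) u) atTop
    (nhds (iteratedDeriv k (f none) u))
  bound : ∀ k R, ∃ C, ∀ n u, |u| ≤ R → ‖iteratedDeriv k (f n) u‖ ≤ C

namespace SmoothFam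

variable {f : Option ℕ → ℝ → ℂ}

lemma deriv (hf : SmoothFam f) : SmoothFam (fun n => deriv (f n)) where
  contDiff n := (contDiff_infty_iff_deriv.1 (hf.contDiff n)).2
  tendsto k u := by simpa only [iteratedDeriv_succ'] using hf.tendsto (k + 1) u
  bound k R := by simpa only [iteratedDeriv_succ'] using hf.bound (k + 1) R

lemma hasDerivAt (hf : SmoothFam f) (n : Option ℕ) (u : ℝ) :
    HasDerivAt (f n) (_root_.deriv (f n) u) u :=
  ((contDiff_infty_iff_deriv.1 (hf.contDiff n)).1 u).hasDerivAt

lemma continuous (hf : SmoothFam f) (n : Option ℕ) : Continuous (f n) :=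
  (hf.contDiff n).continuous

lemma tendsto_zero (hf : SmoothFam f) (u : ℝ) :
    Tendsto (fun N => f (some N) u) atTop (nhds (f none u)) := by
  simpa using hf.tendsto 0 u

lemma bound_zero (hf : SmoothFam f) (R : ℝ) : ∃ C, ∀ n u, |u| ≤ R → ‖f n u‖ ≤ C := by
  simpa using hf.bound 0 R

end SmoothFam

/-- The weighted average of `f` over the segment between the two coordinates of `z`. -/
def segAvg (a b : ℕ) (f : ℝ → ℂ) (z : ℝ × ℝ) : ℂ :=
  ∫ t in (0 : ℝ)..1, (((1 - t) ^ a * t ^ b : ℝ) : ℂ) * f ((1 - t) * z.1 + t * z.2)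

/-- The linear map on `ℝ × ℝ` with partial derivatives `c` and `d`. -/
def gradMap (c d : ℂ) : ℝ × ℝ →L[ℝ] ℂ :=
  (ContinuousLinearMap.fst ℝ ℝ ℝ).smulRight c + (ContinuousLinearMap.snd ℝ ℝ ℝ).smulRight d

lemma abs_segment_le {t R : ℝ} (ht : t ∈ Set.uIoc (0 : ℝ) 1) {z : ℝ × ℝ} (hz : ‖z‖ ≤ R) :
    |(1 - t) * z.1 + t * z.2| ≤ R := by
  rw [Set.uIoc_of_le zero_le_one] at ht
  have h1 := (norm_fst_le z).trans hz
  have h2 := (norm_snd_le z).trans hz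
  rw [Real.norm_eq_abs, abs_le] at h1 h2
  rw [abs_le]
  constructor <;> nlinarith [ht.1, ht.2]

lemma norm_segWeight_le {t : ℝ} (ht : t ∈ Set.uIoc (0 : ℝ) 1) (a b : ℕ) :
    ‖(((1 - t) ^ a * t ^ b : ℝ) : ℂ)‖ ≤ 1 := by
  rw [Set.uIoc_of_le zero_le_one] at ht
  have h1 : (1 - t) ^ a ≤ 1 := pow_le_one₀ (by linarith [ht.2]) (by linarith [ht.1])
  have h2 : t ^ b ≤ 1 := pow_le_one₀ ht.1.le ht.2
  have h3 : 0 ≤ (1 - t) ^ a := pow_nonneg (by linarith [ht.2]) _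
  have h4 : 0 ≤ t ^ b := pow_nonneg ht.1.le _
  rw [Complex.norm_real, Real.norm_of_nonneg (by positivity)]
  nlinarith

lemma norm_segAvg_integrand_le {f : ℝ → ℂ} {C R t : ℝ} (hC : ∀ u, |u| ≤ R → ‖f u‖ ≤ C)
    (ht : t ∈ Set.uIoc (0 : ℝ) 1) {z : ℝ × ℝ} (hz : ‖z‖ ≤ R) (a b : ℕ) :
    ‖(((1 - t) ^ a * t ^ b : ℝ) : ℂ) * f ((1 - t) * z.1 + t * z.2)‖ ≤ C := by
  rw [norm_mul]
  have h := hC _ (abs_segment_le ht hz)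
  nlinarith [norm_segWeight_le ht a b, norm_nonneg (f ((1 - t) * z.1 + t * z.2)),
    norm_nonneg (((1 - t) ^ a * t ^ b : ℝ) : ℂ)]

lemma norm_segAvg_le {f : ℝ → ℂ} {C R : ℝ} (hC : ∀ u, |u| ≤ R → ‖f u‖ ≤ C)
    {z : ℝ × ℝ} (hz : ‖z‖ ≤ R) (a b : ℕ) : ‖segAvg a b f z‖ ≤ C := by
  have := intervalIntegral.norm_integral_le_of_norm_le_const (a := (0 : ℝ)) (b := 1)
    fun t ht => norm_segAvg_integrand_le hC ht hz a b
  simpa [segAvg] using this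

lemma continuous_segAvg_integrand {f : ℝ → ℂ} (hf : Continuous f) (a b : ℕ) (z : ℝ × ℝ) :
    Continuous fun t : ℝ => (((1 - t) ^ a * t ^ b : ℝ) : ℂ) * f ((1 - t) * z.1 + t * z.2) := by
  fun_prop

lemma continuous_gradMap {c d : ℝ → ℂ} (hc : Continuous c) (hd : Continuous d) :
    Continuous fun t => gradMap (c t) (d t) :=
  ((ContinuousLinearMap.smulRightL ℝ (ℝ × ℝ) ℂ (ContinuousLinearMap.fst ℝ ℝ ℝ)).continuous.comp
    hc).add
  ((ContinuousLinearMap.smulRightL ℝ (ℝ × ℝ) ℂ (ContinuousLinearMap.snd ℝ ℝ ℝ)).continuous.comp hd)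

lemma integral_gradMap {c d : ℝ → ℂ} (hc : Continuous c) (hd : Continuous d) :
    ∫ t in (0 : ℝ)..1, gradMap (c t) (d t) =
      gradMap (∫ t in (0 : ℝ)..1, c t) (∫ t in (0 : ℝ)..1, d t) := by
  have h1 := (ContinuousLinearMap.smulRightL ℝ (ℝ × ℝ) ℂ
    (ContinuousLinearMap.fst ℝ ℝ ℝ)).intervalIntegral_comp_comm (μ := volume)
      (hc.intervalIntegrable 0 1)
  have h2 := (ContinuousLinearMap.smulRightL ℝ (ℝ × ℝ) ℂ
    (ContinuousLinearMap.snd ℝ ℝ ℝ)).intervalIntegral_comp_comm (μ := volume)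
      (hd.intervalIntegrable 0 1)
  simp only [ContinuousLinearMap.smulRightL_apply_apply] at h1 h2
  unfold gradMap
  rw [← h1, ← h2, ← intervalIntegral.integral_add (μ := volume)]
  · exact ((ContinuousLinearMap.smulRightL ℝ (ℝ × ℝ) ℂ
      (ContinuousLinearMap.fst ℝ ℝ ℝ)).continuous.comp hc).intervalIntegrable _ _
  · exact ((ContinuousLinearMap.smulRightL ℝ (ℝ × ℝ) ℂ
      (ContinuousLinearMap.snd ℝ ℝ ℝ)).continuous.comp hd).intervalIntegrable _ _

lemma norm_gradMap_le (c d : ℂ) : ‖gradMap c d‖ ≤ ‖c‖ + ‖d‖ := by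
  refine (norm_add_le _ _).trans ?_
  rw [ContinuousLinearMap.norm_smulRight_apply, ContinuousLinearMap.norm_smulRight_apply]
  have h1 := ContinuousLinearMap.norm_fst_le ℝ ℝ ℝ
  have h2 := ContinuousLinearMap.norm_snd_le ℝ ℝ ℝ
  nlinarith [norm_nonneg c, norm_nonneg d]

lemma hasFDerivAt_segAvg {f : ℝ → ℂ} (hf : ContDiff ℝ 1 f) (a b : ℕ) (z : ℝ × ℝ) :
    HasFDerivAt (segAvg a b f)
      (gradMap (segAvg (a + 1) b (deriv f) z) (segAvg a (b + 1) (deriv f) z)) z := by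
  have hf' : Continuous (deriv f) := hf.continuous_deriv le_rfl
  obtain ⟨C, hC⟩ := (isCompact_Icc (a := -(‖z‖ + 1)) (b := ‖z‖ + 1)).exists_bound_of_continuousOn
    hf'.continuousOn
  have hC' : ∀ u, |u| ≤ ‖z‖ + 1 → ‖deriv f u‖ ≤ C := fun u hu => hC u (abs_le.1 hu)
  have key := intervalIntegral.hasFDerivAt_integral_of_dominated_of_fderiv_le (𝕜 := ℝ)
    (μ := volume) (a := (0 : ℝ)) (b := 1) (bound := fun _ => C + C) (s := Metric.ball z 1) (x₀ := z)
    (F := fun z t => (((1 - t) ^ a * t ^ b : ℝ) : ℂ) * f ((1 - t) * z.1 + t * z.2))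
    (F' := fun z t => gradMap
      ((((1 - t) ^ (a + 1) * t ^ b : ℝ) : ℂ) * deriv f ((1 - t) * z.1 + t * z.2))
      ((((1 - t) ^ a * t ^ (b + 1) : ℝ) : ℂ) * deriv f ((1 - t) * z.1 + t * z.2)))
    (Metric.ball_mem_nhds z one_pos)
    (.of_forall fun w => (continuous_segAvg_integrand hf.continuous a b w).aestronglyMeasurable)
    ((continuous_segAvg_integrand hf.continuous a b z).intervalIntegrable _ _)
    (continuous_gradMap (continuous_segAvg_integrand hf' (a + 1) b z)
      (continuous_segAvg_integrand hf' a (b + 1) z)).aestronglyMeasurable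
    (.of_forall fun t ht w hw => ?_) intervalIntegrable_const (.of_forall fun t ht w hw => ?_)
  · rw [integral_gradMap (continuous_segAvg_integrand hf' (a + 1) b z)
      (continuous_segAvg_integrand hf' a (b + 1) z)] at key
    exact key
  · have hw' : ‖w‖ ≤ ‖z‖ + 1 := by
      have h1 : ‖w - z‖ < 1 := by rwa [← dist_eq_norm]
      have h2 : ‖w‖ ≤ ‖z‖ + ‖w - z‖ := by simpa using norm_add_le z (w - z)
      linarith
    exact (norm_gradMap_le _ _).trans (add_le_add
      (norm_segAvg_integrand_le hC' ht hw' (a + 1) b) (norm_segAvg_integrand_le hC' ht hw' a (b + 1)))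
  · have h1 : HasFDerivAt (fun w : ℝ × ℝ => (1 - t) * w.1 + t * w.2)
        ((1 - t) • ContinuousLinearMap.fst ℝ ℝ ℝ + t • ContinuousLinearMap.snd ℝ ℝ ℝ) w :=
      (hasFDerivAt_fst.const_mul (1 - t)).add (hasFDerivAt_snd.const_mul t)
    have h2 := ((hf.differentiable one_ne_zero
      ((1 - t) * w.1 + t * w.2)).hasDerivAt.hasFDerivAt.comp w h1).const_mul
        (((1 - t) ^ a * t ^ b : ℝ) : ℂ)
    refine h2.congr_fderiv ?_
    ext <;> simp [gradMap, pow_succ] <;> ring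

/-- The families of functions on `ℝ × ℝ` generated, as an algebra, by convergent constants, the
coordinates, and the functions `f(u)` and `segAvg a b f (u, v)` for smooth families `f`. -/
inductive AdmFam : (Option ℕ → ℝ × ℝ → ℂ) → Prop
  | const (c : Option ℕ → ℂ) (hc : Tendsto (fun N => c (some N)) atTop (nhds (c none))) :
      AdmFam fun n _ => c n
  | fst : AdmFam fun _ z => (z.1 : ℂ)
  | snd : AdmFam fun _ z => (z.2 : ℂ)
  | comp {f : Option ℕ → ℝ → ℂ} (hf : SmoothFam f) : AdmFam fun n z => f n z.1
  | avg {f : Option ℕ → ℝ → ℂ} (hf : SmoothFam f) (a b : ℕ) : AdmFam fun n z => segAvg a b (f n) z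
  | add {g h : Option ℕ → ℝ × ℝ → ℂ} (hg : AdmFam g) (hh : AdmFam h) :
      AdmFam fun n z => g n z + h n z
  | mul {g h : Option ℕ → ℝ × ℝ → ℂ} (hg : AdmFam g) (hh : AdmFam h) :
      AdmFam fun n z => g n z * h n z

namespace AdmFam

variable {h : Option ℕ → ℝ × ℝ → ℂ}

lemma constant (c : ℂ) : AdmFam fun _ _ => c := const (fun _ => c) tendsto_const_nhds

lemma exists_hasFDerivAt (hh : AdmFam h) : ∃ h₁ h₂, AdmFam h₁ ∧ AdmFam h₂ ∧
    ∀ n z, HasFDerivAt (h n) (gradMap (h₁ n z) (h₂ n z)) z := by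
  induction hh with
  | const c hc =>
    refine ⟨_, _, constant 0, constant 0, fun n z => (hasFDerivAt_const _ _).congr_fderiv ?_⟩
    ext <;> simp [gradMap]
  | fst =>
    refine ⟨_, _, constant 1, constant 0, fun n z =>
      (Complex.ofRealCLM.hasFDerivAt.comp z hasFDerivAt_fst).congr_fderiv ?_⟩
    ext <;> simp [gradMap]
  | snd =>
    refine ⟨_, _, constant 0, constant 1, fun n z =>
      (Complex.ofRealCLM.hasFDerivAt.comp z hasFDerivAt_snd).congr_fderiv ?_⟩
    ext <;> simp [gradMap]
  | comp hf =>
    refine ⟨_, _, comp hf.deriv, constant 0, fun n z =>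
      ((hf.hasDerivAt n z.1).hasFDerivAt.comp z hasFDerivAt_fst).congr_fderiv ?_⟩
    ext <;> simp [gradMap]
  | avg hf a b =>
    exact ⟨_, _, avg hf.deriv (a + 1) b, avg hf.deriv a (b + 1), fun n z =>
      hasFDerivAt_segAvg ((hf.contDiff n).of_le (mod_cast le_top)) a b z⟩
  | add _ _ ihg ihh =>
    obtain ⟨g₁, g₂, hg₁, hg₂, hg⟩ := ihg
    obtain ⟨h₁, h₂, hh₁, hh₂, hh⟩ := ihh
    refine ⟨_, _, hg₁.add hh₁, hg₂.add hh₂, fun n z => ((hg n z).add (hh n z)).congr_fderiv ?_⟩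
    ext <;> simp [gradMap]
  | mul hg' hh' ihg ihh =>
    obtain ⟨g₁, g₂, hg₁, hg₂, hg⟩ := ihg
    obtain ⟨h₁, h₂, hh₁, hh₂, hh⟩ := ihh
    refine ⟨_, _, (hg'.mul hh₁).add (hh'.mul hg₁), (hg'.mul hh₂).add (hh'.mul hg₂),
      fun n z => ((hg n z).mul (hh n z)).congr_fderiv ?_⟩
    ext <;> simp [gradMap]

lemma contDiff (hh : AdmFam h) (n : Option ℕ) : ContDiff ℝ (⊤ : ℕ∞) (h n) := by
  refine contDiff_infty.2 fun k => ?_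
  induction k generalizing h with
  | zero =>
    obtain ⟨h₁, h₂, -, -, hd⟩ := hh.exists_hasFDerivAt
    exact contDiff_zero.2 (continuous_iff_continuousAt.2 fun z => (hd n z).continuousAt)
  | succ k ih =>
    obtain ⟨h₁, h₂, hh₁, hh₂, hd⟩ := hh.exists_hasFDerivAt
    push_cast
    exact contDiff_succ_iff_hasFDerivAt.2 ⟨_, (contDiff_const.smulRight (ih hh₁)).add
      (contDiff_const.smulRight (ih hh₂)), hd n⟩

lemma exists_hasDerivAt_fst (hh : AdmFam h) : ∃ h₁, AdmFam h₁ ∧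
    ∀ n u v, HasDerivAt (fun u => h n (u, v)) (h₁ n (u, v)) u := by
  obtain ⟨h₁, h₂, hh₁, -, hd⟩ := hh.exists_hasFDerivAt
  refine ⟨h₁, hh₁, fun n u v => ?_⟩
  simpa [gradMap, Function.comp_def] using (hd n (u, v)).comp_hasDerivAt u
    ((hasDerivAt_id u).prodMk (hasDerivAt_const u v))

lemma exists_hasDerivAt_snd (hh : AdmFam h) : ∃ h₂, AdmFam h₂ ∧
    ∀ n u v, HasDerivAt (fun v => h n (u, v)) (h₂ n (u, v)) v := by
  obtain ⟨h₁, h₂, -, hh₂, hd⟩ := hh.exists_hasFDerivAt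
  refine ⟨h₂, hh₂, fun n u v => ?_⟩
  simpa [gradMap, Function.comp_def] using (hd n (u, v)).comp_hasDerivAt v
    ((hasDerivAt_const v u).prodMk (hasDerivAt_id v))

lemma tendsto (hh : AdmFam h) (z : ℝ × ℝ) :
    Tendsto (fun N => h (some N) z) atTop (nhds (h none z)) := by
  induction hh with
  | const c hc => exact hc
  | fst => exact tendsto_const_nhds
  | snd => exact tendsto_const_nhds
  | comp hf => exact hf.tendsto_zero z.1
  | avg hf a b =>
    obtain ⟨C, hC⟩ := hf.bound_zero ‖z‖
    exact intervalIntegral.tendsto_integral_filter_of_dominated_convergence (fun _ => C)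
      (.of_forall fun N => (continuous_segAvg_integrand (hf.continuous _) a b z).aestronglyMeasurable)
      (.of_forall fun N => .of_forall fun t ht =>
        norm_segAvg_integrand_le (hC (some N)) ht le_rfl a b)
      intervalIntegrable_const (.of_forall fun t ht => (hf.tendsto_zero _).const_mul _)
  | add _ _ ihg ihh => exact ihg.add ihh
  | mul _ _ ihg ihh => exact ihg.mul ihh

lemma bound (hh : AdmFam h) (R : ℝ) : ∃ C, ∀ n z, ‖z‖ ≤ R → ‖h n z‖ ≤ C := by
  induction hh with
  | const c hc =>
    obtain ⟨C, hC⟩ := hc.norm.bddAbove_range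
    refine ⟨max C ‖c none‖, fun n z _ => ?_⟩
    cases n with
    | none => exact le_max_right _ _
    | some N => exact (hC ⟨N, rfl⟩).trans (le_max_left _ _)
  | fst => exact ⟨R, fun n z hz => by simpa using (norm_fst_le z).trans hz⟩
  | snd => exact ⟨R, fun n z hz => by simpa using (norm_snd_le z).trans hz⟩
  | comp hf =>
    obtain ⟨C, hC⟩ := hf.bound_zero R
    exact ⟨C, fun n z hz => hC n z.1 ((norm_fst_le z).trans hz)⟩
  | avg hf a b =>
    obtain ⟨C, hC⟩ := hf.bound_zero R
    exact ⟨C, fun n z hz => norm_segAvg_le (hC n) hz a b⟩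
  | add _ _ ihg ihh =>
    obtain ⟨C, hC⟩ := ihg
    obtain ⟨D, hD⟩ := ihh
    exact ⟨C + D, fun n z hz => (norm_add_le _ _).trans (add_le_add (hC n z hz) (hD n z hz))⟩
  | mul _ _ ihg ihh =>
    obtain ⟨C, hC⟩ := ihg
    obtain ⟨D, hD⟩ := ihh
    exact ⟨C * D, fun n z hz => (norm_mul_le_of_le (hC n z hz) (hD n z hz))⟩

end AdmFam

lemma segAvg_deriv_of_ne {f : ℝ → ℂ} (hf : ContDiff ℝ 1 f) {u v : ℝ} (huv : u ≠ v) :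
    segAvg 0 0 (deriv f) (u, v) = (f v - f u) / ((v : ℂ) - (u : ℂ)) := by
  have hne : (v : ℂ) - (u : ℂ) ≠ 0 := by
    rw [← Complex.ofReal_sub, Complex.ofReal_ne_zero]
    exact sub_ne_zero.2 huv.symm
  have hd : ∀ t ∈ Set.uIcc (0 : ℝ) 1, HasDerivAt (fun t : ℝ => f ((1 - t) * u + t * v))
      (((v : ℂ) - (u : ℂ)) * deriv f ((1 - t) * u + t * v)) t := fun t _ => by
    have h1 : HasDerivAt (fun t : ℝ => (1 - t) * u + t * v) (v - u) t := by
      have := (((hasDerivAt_id t).const_sub 1).mul_const u).add ((hasDerivAt_id t).mul_const v)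
      refine this.congr_deriv ?_
      ring
    have h2 := (hf.differentiable one_ne_zero ((1 - t) * u + t * v)).hasDerivAt.scomp t h1
    refine h2.congr_deriv ?_
    rw [← Complex.ofReal_sub, Complex.real_smul]
  have hc : Continuous fun t : ℝ => ((v : ℂ) - (u : ℂ)) * deriv f ((1 - t) * u + t * v) := by
    have := hf.continuous_deriv le_rfl
    fun_prop
  have h := intervalIntegral.integral_eq_sub_of_hasDerivAt hd (hc.intervalIntegrable 0 1)
  rw [intervalIntegral.integral_const_mul] at h
  rw [eq_div_iff hne, mul_comm]
  simpa [segAvg] using h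

lemma segAvg_diag (f : ℝ → ℂ) (u : ℝ) : segAvg 0 0 f (u, u) = f u := by
  have : ∀ t : ℝ, (1 - t) * u + t * u = u := fun t => by ring
  simp [segAvg, this]

/-- The smooth extension of `(f(u) g(v) - g(u) f(v)) / (v - u)`. -/
def wronskKernel (f g : ℝ → ℂ) (z : ℝ × ℝ) : ℂ :=
  f z.1 * segAvg 0 0 (deriv g) z - g z.1 * segAvg 0 0 (deriv f) z

lemma AdmFam.wronskKernel {f g : Option ℕ → ℝ → ℂ} (hf : SmoothFam f) (hg : SmoothFam g) :
    AdmFam fun n z => wronskKernel (f n) (g n) z := by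
  have := ((comp hf).mul (avg hg.deriv 0 0)).add
    ((constant (-1)).mul ((comp hg).mul (avg hf.deriv 0 0)))
  convert this using 3
  rw [_root_.wronskKernel]
  ring

/-- `κ` is locally constant away from the origin. -/
def LocConst (κ : ℝ → ℂ) : Prop := ∀ x, x ≠ 0 → κ =ᶠ[nhds x] fun _ => κ x

lemma LocConst.hasDerivAt {κ : ℝ → ℂ} (hκ : LocConst κ) {x : ℝ} (hx : x ≠ 0) :
    HasDerivAt κ 0 x :=
  (hasDerivAt_const x (κ x)).congr_of_eventuallyEq (hκ x hx)

lemma LocConst.mul {κ μ : ℝ → ℂ} (hκ : LocConst κ) (hμ : LocConst μ) :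
    LocConst fun x => κ x * μ x :=
  fun x hx => (hκ x hx).mul (hμ x hx)

lemma LocConst.pow {κ : ℝ → ℂ} (hκ : LocConst κ) (k : ℕ) : LocConst fun x => κ x ^ k :=
  fun x hx => (hκ x hx).pow_const k

lemma locConst_of_sign (F : ℝ → ℂ) : LocConst fun x => F (Real.sign x) := by
  intro x hx
  rcases hx.lt_or_gt with h | h
  · filter_upwards [Iio_mem_nhds h] with y hy
    rw [Real.sign_of_neg h, Real.sign_of_neg hy]
  · filter_upwards [Ioi_mem_nhds h] with y hy
    rw [Real.sign_of_pos h, Real.sign_of_pos hy]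

lemma abs_eq_sign_mul (x : ℝ) : |x| = Real.sign x * x := by
  rcases lt_trichotomy x 0 with h | h | h
  · rw [Real.sign_of_neg h, abs_of_neg h]; ring
  · simp [h]
  · rw [Real.sign_of_pos h, abs_of_pos h]; ring

lemma sign_mul_self_of_ne_zero {x : ℝ} (hx : x ≠ 0) : Real.sign x * Real.sign x = 1 := by
  rcases hx.lt_or_gt with h | h
  · rw [Real.sign_of_neg h]; ring
  · rw [Real.sign_of_pos h]; ring

lemma abs_rpow_neg_mul_inv {x : ℝ} (hx : x ≠ 0) (b : ℝ) :
    |x| ^ (-b) * x⁻¹ = Real.sign x * |x| ^ (-(b + 1)) := by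
  have hx' : 0 < |x| := abs_pos.2 hx
  rw [neg_add, Real.rpow_add hx', Real.rpow_neg_one, abs_eq_sign_mul x, mul_inv,
    inv_eq_of_mul_eq_one_right (sign_mul_self_of_ne_zero hx)]
  linear_combination (-(Real.sign x * x) ^ (-b) * x⁻¹) * sign_mul_self_of_ne_zero hx

lemma hasDerivAt_abs_rpow_neg {x : ℝ} (hx : x ≠ 0) (b : ℝ) :
    HasDerivAt (fun x : ℝ => |x| ^ (-b)) (-b * (|x| ^ (-b) * x⁻¹)) x := by
  have h := (hasDerivAt_abs hx).rpow_const (p := -b) (Or.inl (abs_ne_zero.2 hx))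
  refine h.congr_deriv ?_
  have hs : ((SignType.sign x : SignType) : ℝ) = |x| * x⁻¹ := by
    rw [← sign_mul_abs x, abs_mul, abs_abs]
    rcases hx.lt_or_gt with h | h
    · simp [h, abs_of_neg h, hx]
    · simp [h, abs_of_pos h, hx]
  rw [hs, Real.rpow_sub_one (abs_ne_zero.2 hx)]
  field_simp

lemma hasDerivAt_weighted {κ h : ℝ → ℂ} {h' : ℂ} {x : ℝ} (hκ : LocConst κ) (hx : x ≠ 0) (b : ℝ)
    (hh : HasDerivAt h h' x⁻¹) :
    HasDerivAt (fun x => κ x * ((|x| ^ (-b) : ℝ) : ℂ) * h x⁻¹)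
      (κ x * Real.sign x * ((|x| ^ (-(b + 1)) : ℝ) : ℂ) *
        (-(b : ℂ) * h x⁻¹ + -1 * (((x⁻¹ : ℝ) : ℂ) * h'))) x := by
  have h1 := (hκ.hasDerivAt hx).mul (hasDerivAt_abs_rpow_neg hx b).ofReal_comp
  have h2 := h1.mul (hh.scomp x (hasDerivAt_inv hx))
  refine h2.congr_deriv ?_
  have h3 := congrArg (fun r : ℝ => (r : ℂ)) (abs_rpow_neg_mul_inv hx b)
  push_cast at h3 ⊢
  simp only [Complex.real_smul, Function.comp, Pi.mul_apply]
  push_cast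
  linear_combination (κ x * (-(b : ℂ) * h x⁻¹ - (x : ℂ)⁻¹ * h')) * h3

lemma wronskian_quotient_eq {φ ψ f g κ : ℝ → ℂ} {b : ℝ} (hκ : LocConst κ) (hf : ContDiff ℝ 1 f)
    (hg : ContDiff ℝ 1 g) (hφ : ∀ x, x ≠ 0 → φ x = κ x * ((|x| ^ (-b) : ℝ) : ℂ) * f x⁻¹)
    (hψ : ∀ x, x ≠ 0 → ψ x = κ x * ((|x| ^ (-b) : ℝ) : ℂ) * g x⁻¹) {x y : ℝ} (hx : x ≠ 0)
    (hy : y ≠ 0) :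
    (if x = y then deriv φ x * ψ x - deriv ψ x * φ x
      else (φ x * ψ y - ψ x * φ y) / ((x : ℂ) - (y : ℂ))) =
    κ x * Real.sign x * ((|x| ^ (-(b + 1)) : ℝ) : ℂ) *
      (κ y * Real.sign y * ((|y| ^ (-(b + 1)) : ℝ) : ℂ) * wronskKernel f g (x⁻¹, y⁻¹)) := by
  have hC (x : ℝ) (hx : x ≠ 0) : ((|x| ^ (-b) : ℝ) : ℂ) * (x : ℂ)⁻¹ =
      Real.sign x * ((|x| ^ (-(b + 1)) : ℝ) : ℂ) := by
    exact_mod_cast congrArg (fun r : ℝ => (r : ℂ)) (abs_rpow_neg_mul_inv hx b)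
  have hxC : (x : ℂ) ≠ 0 := Complex.ofReal_ne_zero.2 hx
  have hyC : (y : ℂ) ≠ 0 := Complex.ofReal_ne_zero.2 hy
  rw [mul_assoc (κ x), mul_assoc (κ y), ← hC x hx, ← hC y hy]
  split_ifs with hxy
  · subst hxy
    have hd : ∀ {F ω : ℝ → ℂ}, ContDiff ℝ 1 F →
        (∀ x, x ≠ 0 → ω x = κ x * ((|x| ^ (-b) : ℝ) : ℂ) * F x⁻¹) →
        deriv ω x = κ x * (Real.sign x * ((|x| ^ (-(b + 1)) : ℝ) : ℂ)) *
        (-(b : ℂ) * F x⁻¹ + -1 * (((x⁻¹ : ℝ) : ℂ) * deriv F x⁻¹)) := fun {F ω} hF hω => by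
      rw [← mul_assoc (κ x)]
      refine ((hasDerivAt_weighted hκ hx b
        (hF.differentiable one_ne_zero x⁻¹).hasDerivAt).congr_of_eventuallyEq ?_).deriv
      filter_upwards [isOpen_ne.mem_nhds hx] with y hy using hω y hy
    rw [hd hf hφ, hd hg hψ, hφ x hx, hψ x hx, ← hC x hx, wronskKernel, segAvg_diag, segAvg_diag]
    push_cast
    ring
  · have hinv : x⁻¹ ≠ y⁻¹ := fun h => hxy (inv_injective h)
    have h1 : (x : ℂ) - (y : ℂ) ≠ 0 := by
      rw [← Complex.ofReal_sub, Complex.ofReal_ne_zero]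
      exact sub_ne_zero.2 hxy
    rw [hφ x hx, hφ y hy, hψ x hx, hψ y hy, wronskKernel, segAvg_deriv_of_ne hf hinv,
      segAvg_deriv_of_ne hg hinv]
    have h2 : ((y⁻¹ : ℝ) : ℂ) - ((x⁻¹ : ℝ) : ℂ) = ((x : ℂ) - y) / (x * y) := by
      push_cast
      field_simp
    rw [h2]
    field_simp
    ring

section Weighted

variable {K : Option ℕ → ℝ → ℝ → ℝ} {κ : Option ℕ → ℝ → ℂ} {b : ℝ}
  {h : Option ℕ → ℝ × ℝ → ℂ}

lemma locConst_sign : LocConst fun x => (Real.sign x : ℂ) :=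
  locConst_of_sign fun r => (r : ℂ)

lemma exists_iteratedDeriv_snd (hκ : ∀ n, LocConst (κ n)) (hh : AdmFam h)
    (hK : ∀ n x y, x ≠ 0 → y ≠ 0 → K n x y = (κ n x * ((|x| ^ (-b) : ℝ) : ℂ) *
      (κ n y * ((|y| ^ (-b) : ℝ) : ℂ) * h n (x⁻¹, y⁻¹))).re) (q : ℕ) :
    ∃ h', AdmFam h' ∧ ∀ n x y, x ≠ 0 → y ≠ 0 →
      iteratedDeriv q (K n x) y = (κ n x * ((|x| ^ (-b) : ℝ) : ℂ) *
        (κ n y * (Real.sign y : ℂ) ^ q * ((|y| ^ (-(b + q)) : ℝ) : ℂ) * h' n (x⁻¹, y⁻¹))).re := by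
  induction q with
  | zero => exact ⟨h, hh, by simpa using hK⟩
  | succ q ih =>
    obtain ⟨h', hh', hq⟩ := ih
    obtain ⟨h₂, hh₂, hd⟩ := hh'.exists_hasDerivAt_snd
    refine ⟨_, ((AdmFam.constant (-((b + q : ℝ) : ℂ))).mul hh').add
      ((AdmFam.constant (-1)).mul (AdmFam.snd.mul hh₂)), fun n x y hx hy => ?_⟩
    have h1 := ((hasDerivAt_weighted ((hκ n).mul (locConst_sign.pow q)) hy (b + q)
      (hd n x⁻¹ y⁻¹)).const_mul (κ n x * ((|x| ^ (-b) : ℝ) : ℂ)))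
    have h2 := Complex.reCLM.hasFDerivAt.comp_hasDerivAt y h1
    rw [iteratedDeriv_succ]
    refine (h2.congr_of_eventuallyEq ?_).deriv.trans ?_
    · filter_upwards [isOpen_ne.mem_nhds hy] with w hw using hq n x w hx hw
    · rw [Complex.reCLM_apply]
      congr 1
      push_cast
      rw [← add_assoc]
      ring

lemma exists_pderiv₂_eq (hκ : ∀ n, LocConst (κ n)) (hh : AdmFam h)
    (hK : ∀ n x y, x ≠ 0 → y ≠ 0 → K n x y = (κ n x * ((|x| ^ (-b) : ℝ) : ℂ) *
      (κ n y * ((|y| ^ (-b) : ℝ) : ℂ) * h n (x⁻¹, y⁻¹))).re) (p q : ℕ) :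
    ∃ h', AdmFam h' ∧ ∀ n x y, x ≠ 0 → y ≠ 0 →
      pderiv₂ (K n) p q x y =
        (κ n x * (Real.sign x : ℂ) ^ p * ((|x| ^ (-(b + p)) : ℝ) : ℂ) *
        (κ n y * (Real.sign y : ℂ) ^ q * ((|y| ^ (-(b + q)) : ℝ) : ℂ) * h' n (x⁻¹, y⁻¹))).re := by
  induction p with
  | zero => simpa [pderiv₂] using exists_iteratedDeriv_snd hκ hh hK q
  | succ p ih =>
    obtain ⟨h', hh', hp⟩ := ih
    obtain ⟨h₁, hh₁, hd⟩ := hh'.exists_hasDerivAt_fst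
    refine ⟨_, ((AdmFam.constant (-((b + p : ℝ) : ℂ))).mul hh').add
      ((AdmFam.constant (-1)).mul (AdmFam.fst.mul hh₁)), fun n x y hx hy => ?_⟩
    have h1 := hasDerivAt_weighted ((hκ n).mul (locConst_sign.pow p)) hx (b + p)
      ((hd n x⁻¹ y⁻¹).const_mul
        (κ n y * (Real.sign y : ℂ) ^ q * ((|y| ^ (-(b + q)) : ℝ) : ℂ)))
    have h2 := Complex.reCLM.hasFDerivAt.comp_hasDerivAt x h1
    rw [pderiv₂, iteratedDeriv_succ]
    refine (h2.congr_of_eventuallyEq ?_).deriv.trans ?_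
    · filter_upwards [isOpen_ne.mem_nhds hx] with w hw using hp n w y hw hy
    · rw [Complex.reCLM_apply]
      congr 1
      push_cast
      rw [← add_assoc]
      ring

lemma contDiffOn_of_weighted (hκ : ∀ n, LocConst (κ n)) (hh : AdmFam h)
    (hK : ∀ n x y, x ≠ 0 → y ≠ 0 → K n x y = (κ n x * ((|x| ^ (-b) : ℝ) : ℂ) *
      (κ n y * ((|y| ^ (-b) : ℝ) : ℂ) * h n (x⁻¹, y⁻¹))).re) (n : Option ℕ) :
    ContDiffOn ℝ (⊤ : ℕ∞) (Function.uncurry (K n)) ({0}ᶜ ×ˢ {0}ᶜ) := by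
  have hw : ∀ x : ℝ, x ≠ 0 →
      ContDiffAt ℝ (⊤ : ℕ∞) (fun x : ℝ => κ n x * ((|x| ^ (-b) : ℝ) : ℂ)) x := fun x hx =>
    (contDiffAt_const.congr_of_eventuallyEq (hκ n x hx)).mul
      (Complex.ofRealCLM.contDiff.contDiffAt.comp x
        ((contDiffAt_abs hx).rpow_const_of_ne (abs_ne_zero.2 hx)))
  rintro ⟨x, y⟩ ⟨hx, hy⟩
  have hx : x ≠ 0 := hx
  have hy : y ≠ 0 := hy
  have hi : ContDiffAt ℝ (⊤ : ℕ∞) (fun z : ℝ × ℝ => (z.1⁻¹, z.2⁻¹)) (x, y) :=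
    (contDiffAt_fst.inv hx).prodMk (contDiffAt_snd.inv hy)
  have h1 := ((hw x hx).comp (x, y) contDiffAt_fst).mul
    (((hw y hy).comp (x, y) contDiffAt_snd).mul ((hh.contDiff n).contDiffAt.comp (x, y) hi))
  refine ((Complex.reCLM.contDiff.contDiffAt.comp (x, y) h1).congr_of_eventuallyEq
    ?_).contDiffWithinAt
  filter_upwards [(isOpen_ne.prod isOpen_ne).mem_nhds
    (show (x, y) ∈ {x : ℝ | x ≠ 0} ×ˢ {x : ℝ | x ≠ 0} from ⟨hx, hy⟩)] with z hz
    using hK n z.1 z.2 hz.1 hz.2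

lemma tendsto_pderiv₂_of_weighted (hκ : ∀ n, LocConst (κ n)) (hh : AdmFam h)
    (hK : ∀ n x y, x ≠ 0 → y ≠ 0 → K n x y = (κ n x * ((|x| ^ (-b) : ℝ) : ℂ) *
      (κ n y * ((|y| ^ (-b) : ℝ) : ℂ) * h n (x⁻¹, y⁻¹))).re)
    (hκs : ∀ N x, κ (some N) x = (Real.sign x : ℂ) ^ (N + 1) * κ none x)
    (p q : ℕ) {x y : ℝ} (hx : x ≠ 0) (hy : y ≠ 0) :
    Tendsto (fun N : ℕ => Real.sign (x * y) ^ (N + 1) * pderiv₂ (K (some N)) p q x y) atTop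
      (nhds (pderiv₂ (K none) p q x y)) := by
  obtain ⟨h', hh', hpq⟩ := exists_pderiv₂_eq hκ hh hK p q
  have h1 := (Complex.continuous_re.tendsto _).comp ((hh'.tendsto (x⁻¹, y⁻¹)).const_mul
    (κ none x * (Real.sign x : ℂ) ^ p * ((|x| ^ (-(b + p)) : ℝ) : ℂ) *
      (κ none y * (Real.sign y : ℂ) ^ q * ((|y| ^ (-(b + q)) : ℝ) : ℂ))))
  rw [hpq none x y hx hy]
  refine (h1.congr fun N => ?_).trans_eq ?_
  · rw [hpq _ x y hx hy, hκs, hκs, ← Complex.re_ofReal_mul, Function.comp_apply]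
    congr 1
    have hsx : (Real.sign x : ℂ) * Real.sign x = 1 := by
      exact_mod_cast sign_mul_self_of_ne_zero hx
    have hsy : (Real.sign y : ℂ) * Real.sign y = 1 := by
      exact_mod_cast sign_mul_self_of_ne_zero hy
    have hxy : Real.sign (x * y) = Real.sign x * Real.sign y := by
      rcases hx.lt_or_gt with h | h <;> rcases hy.lt_or_gt with h' | h'
      · rw [Real.sign_of_neg h, Real.sign_of_neg h', Real.sign_of_pos (mul_pos_of_neg_of_neg h h')]
        norm_num
      · rw [Real.sign_of_neg h, Real.sign_of_pos h', Real.sign_of_neg (mul_neg_of_neg_of_pos h h')]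
        norm_num
      · rw [Real.sign_of_pos h, Real.sign_of_neg h', Real.sign_of_neg (mul_neg_of_pos_of_neg h h')]
        norm_num
      · rw [Real.sign_of_pos h, Real.sign_of_pos h', Real.sign_of_pos (mul_pos h h')]
        norm_num
    have hsx' : (Real.sign x : ℂ) ^ (N + 1) * (Real.sign x : ℂ) ^ (N + 1) = 1 := by
      rw [← mul_pow, hsx, one_pow]
    have hsy' : (Real.sign y : ℂ) ^ (N + 1) * (Real.sign y : ℂ) ^ (N + 1) = 1 := by
      rw [← mul_pow, hsy, one_pow]
    rw [hxy]
    push_cast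
    rw [mul_pow]
    generalize (Real.sign x : ℂ) ^ (N + 1) = X at *
    generalize (Real.sign y : ℂ) ^ (N + 1) = Y at *
    generalize (Real.sign x : ℂ) ^ p = X' at *
    generalize (Real.sign y : ℂ) ^ q = Y' at *
    generalize h' (some N) (x⁻¹, y⁻¹) = H at *
    generalize ((|x| ^ (-(b + p)) : ℝ) : ℂ) = A at *
    generalize ((|y| ^ (-(b + q)) : ℝ) : ℂ) = B at *
    linear_combination (-(κ none x * X' * A * κ none y * Y' * B * H)) * hsx' * Y * Y -
      (κ none x * X' * A * κ none y * Y' * B * H) * hsy'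
  · rw [mul_assoc _ _ (h' none (x⁻¹, y⁻¹))]

lemma exists_bound_pderiv₂_of_weighted (hκ : ∀ n, LocConst (κ n)) (hh : AdmFam h)
    (hK : ∀ n x y, x ≠ 0 → y ≠ 0 → K n x y = (κ n x * ((|x| ^ (-b) : ℝ) : ℂ) *
      (κ n y * ((|y| ^ (-b) : ℝ) : ℂ) * h n (x⁻¹, y⁻¹))).re)
    {M : ℝ} (hM : ∀ n x, ‖κ n x‖ ≤ M) {x₀ : ℝ} (hx₀ : 0 < x₀) (p q : ℕ) :
    ∃ C, ∀ n x y, x₀ ≤ |x| → x₀ ≤ |y| →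
      |pderiv₂ (K n) p q x y| ≤ C / (|x| ^ (b + p) * |y| ^ (b + q)) := by
  obtain ⟨h', hh', hpq⟩ := exists_pderiv₂_eq hκ hh hK p q
  obtain ⟨C, hC⟩ := hh'.bound x₀⁻¹
  refine ⟨M * (M * C), fun n x y hx hy => ?_⟩
  have hx' : 0 < |x| := hx₀.trans_le hx
  have hy' : 0 < |y| := hx₀.trans_le hy
  have hH : ‖h' n (x⁻¹, y⁻¹)‖ ≤ C := hC n _ <| by
    rw [Prod.norm_def, max_le_iff]
    simp only [norm_inv, Real.norm_eq_abs]
    exact ⟨inv_anti₀ hx₀ hx, inv_anti₀ hx₀ hy⟩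
  have hs : ∀ z : ℝ, ∀ k : ℕ, ‖(Real.sign z : ℂ) ^ k‖ ≤ 1 := fun z k => by
    rw [norm_pow, Complex.norm_real]
    refine pow_le_one₀ (norm_nonneg _) ?_
    rcases Real.sign_apply_eq z with h | h | h <;> simp [h]
  have hκ' : ∀ z : ℝ, ∀ k : ℕ, ‖κ n z * (Real.sign z : ℂ) ^ k‖ ≤ M := fun z k => by
    simpa using norm_mul_le_of_le (hM n z) (hs z k)
  rw [hpq n x y (abs_pos.1 hx') (abs_pos.1 hy')]
  refine (Complex.abs_re_le_norm _).trans ?_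
  rw [norm_mul, norm_mul, norm_mul _ (h' n _), norm_mul (κ n y * _), Complex.norm_real,
    Complex.norm_real, Real.norm_of_nonneg (Real.rpow_nonneg hx'.le _),
    Real.norm_of_nonneg (Real.rpow_nonneg hy'.le _), Real.rpow_neg hx'.le, Real.rpow_neg hy'.le]
  have hMn : 0 ≤ M := (norm_nonneg _).trans (hM n x)
  calc _ ≤ M * (|x| ^ (b + p))⁻¹ * (M * (|y| ^ (b + q))⁻¹ * C) := by
        gcongr
        · exact hκ' x p
        · exact hκ' y q
    _ = _ := by field_simp

end Weighted

lemma isOpen_strip : IsOpen {z : ℂ | |z.im| < 1} :=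
  isOpen_lt (by fun_prop) continuous_const

lemma abs_im_le_of_mem_closedBall {u r : ℝ} {z : ℂ} (hz : z ∈ Metric.closedBall (u : ℂ) r) :
    |z.im| ≤ r := by
  have h1 : ‖z - u‖ ≤ r := by rwa [← dist_eq_norm]
  have h2 := (Complex.abs_im_le_norm (z - u)).trans h1
  simpa using h2

lemma iteratedDeriv_comp_ofReal {f : ℂ → ℂ} (hf : DifferentiableOn ℂ f {z | |z.im| < 1}) (k : ℕ) :
    iteratedDeriv k (fun u : ℝ => f u) = fun u : ℝ => iteratedDeriv k f u := by
  induction k with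
  | zero => simp
  | succ k ih =>
    funext u
    rw [iteratedDeriv_succ, ih, iteratedDeriv_succ]
    have h1 := (hf.analyticOnNhd isOpen_strip u (by simp)).iterated_deriv k
    rw [← iteratedDeriv_eq_iterate] at h1
    exact (h1.differentiableAt.hasDerivAt.comp_ofReal).deriv

lemma norm_circleMap_half_le {u : ℝ} {z : ℂ} (hz : z ∈ Metric.sphere (u : ℂ) (1 / 2)) :
    ‖z‖ ≤ |u| + 1 / 2 := by
  have h1 : ‖z - u‖ = 1 / 2 := by rwa [← dist_eq_norm]
  have h2 : ‖z‖ ≤ ‖(u : ℂ)‖ + ‖z - u‖ := by simpa using norm_add_le (u : ℂ) (z - u)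
  rwa [h1, Complex.norm_real, Real.norm_eq_abs] at h2

lemma smoothFam_of_holomorphic {F : Option ℕ → ℂ → ℂ}
    (hd : ∀ n, DifferentiableOn ℂ (F n) {z | |z.im| < 1})
    (ht : ∀ z : ℂ, |z.im| < 1 → Tendsto (fun N => F (some N) z) atTop (nhds (F none z)))
    (hb : ∀ R : ℝ, ∃ C : ℝ, ∀ n z, ‖z‖ ≤ R → |z.im| ≤ 1 / 2 → ‖F n z‖ ≤ C) :
    SmoothFam fun n u => F n u := by
  have hball : ∀ u : ℝ, Metric.closedBall (u : ℂ) (1 / 2) ⊆ {z : ℂ | |z.im| < 1} := fun u z hz =>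
    (abs_im_le_of_mem_closedBall hz).trans_lt (by norm_num)
  refine ⟨fun n => contDiff_iff_contDiffAt.2 fun u => ?_, fun k u => ?_, fun k R => ?_⟩
  · have h1 := ((hd n).analyticOnNhd isOpen_strip u (by simp)).restrictScalars (𝕜 := ℝ)
    exact (h1.contDiffAt (n := ((⊤ : ℕ∞) : WithTop ℕ∞))).comp u Complex.ofRealCLM.contDiff.contDiffAt
  · simp only [iteratedDeriv_comp_ofReal (hd _)]
    have hcauchy : ∀ n, iteratedDeriv k (F n) u = (2 * Real.pi * Complex.I / k.factorial : ℂ)⁻¹ *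
        ∮ z in C((u : ℂ), 1 / 2), (1 / (z - u) ^ (k + 1)) • F n z := fun n => by
      rw [((hd n).mono (hball u)).circleIntegral_one_div_sub_center_pow_smul (by norm_num) k,
        smul_eq_mul, inv_mul_cancel_left₀]
      have := Complex.two_pi_I_ne_zero
      have hk : (k.factorial : ℂ) ≠ 0 := Nat.cast_ne_zero.2 k.factorial_ne_zero
      exact div_ne_zero this hk
    simp only [hcauchy]
    refine Tendsto.const_mul _ ?_
    obtain ⟨C, hC⟩ := hb (|u| + 1 / 2)
    have hmem : ∀ θ, circleMap (u : ℂ) (1 / 2) θ ∈ Metric.sphere (u : ℂ) (1 / 2) :=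
      fun θ => circleMap_mem_sphere _ (by norm_num) θ
    have hmem' : ∀ θ, circleMap (u : ℂ) (1 / 2) θ ∈ {z : ℂ | |z.im| < 1} :=
      fun θ => hball u (Metric.sphere_subset_closedBall (hmem θ))
    have hne : ∀ θ, (circleMap (u : ℂ) (1 / 2) θ - u) ^ (k + 1) ≠ 0 := fun θ => by
      refine pow_ne_zero _ (sub_ne_zero.2 ?_)
      exact circleMap_ne_center (by norm_num)
    simp only [circleIntegral]
    refine intervalIntegral.tendsto_integral_filter_of_dominated_convergence
      (fun _ => 1 / 2 * (1 / (1 / 2) ^ (k + 1) * C)) (.of_forall fun N => ?_)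
      (.of_forall fun N => .of_forall fun θ _ => ?_)
      intervalIntegrable_const (.of_forall fun θ _ => ?_)
    · have h1 : Continuous fun θ => F (some N) (circleMap (u : ℂ) (1 / 2) θ) :=
        (hd (some N)).continuousOn.comp_continuous (continuous_circleMap _ _) hmem'
      have h2 : Continuous fun θ => 1 / (circleMap (u : ℂ) (1 / 2) θ - u) ^ (k + 1) :=
        continuous_const.div (((continuous_circleMap _ _).sub continuous_const).pow _) hne
      simp only [deriv_circleMap]
      exact (((continuous_circleMap _ _).mul continuous_const).smul
        (h2.smul h1)).aestronglyMeasurable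
    · have h1 : ‖circleMap (u : ℂ) (1 / 2) θ - u‖ = 1 / 2 := by
        rw [← dist_eq_norm]; exact hmem θ
      rw [norm_smul, norm_smul, norm_div, norm_pow, h1, norm_one, deriv_circleMap, norm_mul,
        norm_circleMap_zero, Complex.norm_I, mul_one, abs_of_pos (by norm_num : (0 : ℝ) < 1 / 2)]
      gcongr
      exact hC _ _ (norm_circleMap_half_le (hmem θ))
        (abs_im_le_of_mem_closedBall (Metric.sphere_subset_closedBall (hmem θ)))
    · exact ((ht _ (hmem' θ)).const_smul _).const_smul _
  · obtain ⟨C, hC⟩ := hb (R + 1 / 2)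
    refine ⟨k.factorial * C / (1 / 2) ^ k, fun n u hu => ?_⟩
    rw [iteratedDeriv_comp_ofReal (hd n)]
    refine Complex.norm_iteratedDeriv_le_of_forall_mem_sphere_norm_le k (by norm_num)
      ((hd n).diffContOnCl_ball (hball u)) fun z hz => ?_
    exact hC n z ((norm_circleMap_half_le hz).trans (by linarith))
      (abs_im_le_of_mem_closedBall (Metric.sphere_subset_closedBall hz))

/-- A convergent sequence of holomorphic functions on the strip `|Im z| < 1`, with its limit (the
value at `none`), bounded on compact sets uniformly along the sequence. -/
structure HolFam (F : Option ℕ → ℂ → ℂ) : Prop where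
  differentiableOn : ∀ n, DifferentiableOn ℂ (F n) {z | |z.im| < 1}
  tendsto : ∀ z : ℂ, |z.im| < 1 → Tendsto (fun N => F (some N) z) atTop (nhds (F none z))
  bound : ∀ R : ℝ, ∃ C : ℝ, ∀ n z, ‖z‖ ≤ R → |z.im| ≤ 1 / 2 → ‖F n z‖ ≤ C

lemma HolFam.mul {F G : Option ℕ → ℂ → ℂ} (hF : HolFam F) (hG : HolFam G) :
    HolFam fun n z => F n z * G n z where
  differentiableOn n := (hF.differentiableOn n).mul (hG.differentiableOn n)
  tendsto z hz := (hF.tendsto z hz).mul (hG.tendsto z hz)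
  bound R := by
    obtain ⟨C, hC⟩ := hF.bound R
    obtain ⟨D, hD⟩ := hG.bound R
    exact ⟨C * D, fun n z hz hz' => norm_mul_le_of_le (hC n z hz hz') (hD n z hz hz')⟩

lemma HolFam.id : HolFam fun _ z => z :=
  ⟨fun _ => differentiableOn_id, fun _ _ => tendsto_const_nhds, fun R => ⟨R, fun _ _ hz _ => hz⟩⟩

lemma HolFam.smoothFam {F : Option ℕ → ℂ → ℂ} (hF : HolFam F) : SmoothFam fun n u => F n u :=
  smoothFam_of_holomorphic hF.differentiableOn hF.tendsto hF.bound

/-- The rescaled variable `iz/N` for `N = n + 1`. -/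
def rotScale (n : ℕ) (z : ℂ) : ℂ := Complex.I * z / ((n + 1 : ℕ) : ℂ)

lemma differentiable_rotScale (n : ℕ) : Differentiable ℂ (rotScale n) := by
  unfold rotScale
  fun_prop

lemma mul_rotScale (n : ℕ) (z : ℂ) : ((n + 1 : ℕ) : ℂ) * rotScale n z = Complex.I * z :=
  mul_div_cancel₀ _ (Nat.cast_ne_zero.2 n.succ_ne_zero)

lemma norm_rotScale (n : ℕ) (z : ℂ) : ‖rotScale n z‖ = ‖z‖ / (n + 1 : ℕ) := by
  rw [rotScale, norm_div, norm_mul, Complex.norm_I, one_mul, Complex.norm_natCast]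

lemma abs_re_rotScale_le (n : ℕ) (z : ℂ) : |(rotScale n z).re| ≤ |z.im| := by
  have h : (rotScale n z).re = -z.im / (n + 1 : ℕ) := by
    rw [rotScale, Complex.div_natCast_re]
    simp
  rw [h, abs_div, abs_neg, Nat.abs_cast]
  exact div_le_self (abs_nonneg _) (by exact_mod_cast Nat.le_add_left 1 n)

lemma le_re_one_add_rotScale {δ : ℝ} {z : ℂ} (hz : |z.im| ≤ 1 - δ) (n : ℕ) :
    δ ≤ (1 + rotScale n z).re := by
  have := abs_le.1 ((abs_re_rotScale_le n z).trans hz)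
  simp only [Complex.add_re, Complex.one_re]
  linarith

lemma le_re_one_sub_rotScale {δ : ℝ} {z : ℂ} (hz : |z.im| ≤ 1 - δ) (n : ℕ) :
    δ ≤ (1 - rotScale n z).re := by
  have := abs_le.1 ((abs_re_rotScale_le n z).trans hz)
  simp only [Complex.sub_re, Complex.one_re]
  linarith

lemma re_one_add_rotScale_pos {z : ℂ} (hz : |z.im| < 1) (n : ℕ) : 0 < (1 + rotScale n z).re :=
  (sub_pos.2 hz).trans_le (le_re_one_add_rotScale (by linarith) n)

lemma re_one_sub_rotScale_pos {z : ℂ} (hz : |z.im| < 1) (n : ℕ) : 0 < (1 - rotScale n z).re :=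
  (sub_pos.2 hz).trans_le (le_re_one_sub_rotScale (by linarith) n)

lemma tendsto_rotScale (z : ℂ) : Tendsto (fun n => rotScale n z) atTop (nhds 0) := by
  rw [tendsto_zero_iff_norm_tendsto_zero]
  simp only [norm_rotScale]
  exact (tendsto_const_div_atTop_nhds_zero_nat ‖z‖).comp (tendsto_add_atTop_nat 1)

lemma norm_log_one_add_le {δ : ℝ} (hδ : 0 < δ) (hδ1 : δ ≤ 1) {w : ℂ} (hw : δ ≤ (1 + w).re) :
    ‖Complex.log (1 + w)‖ ≤ ‖w‖ / δ := by
  have hconv : Convex ℝ {z : ℂ | δ ≤ z.re} := convex_halfSpace_re_ge δ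
  have hs : ∀ z ∈ {z : ℂ | δ ≤ z.re}, z ∈ Complex.slitPlane := fun z hz =>
    Or.inl (hδ.trans_le hz)
  have h := hconv.norm_image_sub_le_of_norm_hasDerivWithin_le (f := Complex.log)
    (f' := fun z => z⁻¹) (C := δ⁻¹) (x := 1) (y := 1 + w)
    (fun z hz => (Complex.hasDerivAt_log (hs z hz)).hasDerivWithinAt)
    (fun z hz => by
      rw [norm_inv]
      exact inv_anti₀ hδ (le_trans hz (Complex.re_le_norm z))) (by simpa using hδ1) hw
  simpa [div_eq_inv_mul] using h

/-- The factor `(1 + w)^(-(N + s̄)/2) (1 - w)^((N - s)/2)` with `w = iz/N`, and its limit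
`e^(-iz)`. -/
def expFam (s : ℂ) : Option ℕ → ℂ → ℂ
  | none, z => Complex.exp (-(Complex.I * z))
  | some n, z => Complex.exp
      ((-((n + 1 : ℕ) : ℂ) - (starRingEnd ℂ) s) / 2 * Complex.log (1 + rotScale n z) +
        (((n + 1 : ℕ) : ℂ) - s) / 2 * Complex.log (1 - rotScale n z))

lemma tendsto_mul_log_one_add_rotScale (z : ℂ) :
    Tendsto (fun n => ((n + 1 : ℕ) : ℂ) * Complex.log (1 + rotScale n z)) atTop
      (nhds (Complex.I * z)) := by
  have h := Complex.tendsto_nat_mul_log_one_add_of_tendsto (g := fun n => Complex.I * z / (n : ℂ))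
    (t := Complex.I * z) ?_
  · exact h.comp (tendsto_add_atTop_nat 1)
  · refine tendsto_const_nhds.congr' ?_
    filter_upwards [eventually_ne_atTop 0] with n hn
    rw [mul_div_cancel₀ _ (Nat.cast_ne_zero.2 hn)]

lemma one_sub_rotScale (n : ℕ) (z : ℂ) : 1 - rotScale n z = 1 + rotScale n (-z) := by
  rw [rotScale, rotScale]
  ring

lemma tendsto_log_one_add_rotScale (z : ℂ) :
    Tendsto (fun n => Complex.log (1 + rotScale n z)) atTop (nhds 0) := by
  have h := (tendsto_rotScale z).const_add 1
  rw [add_zero] at h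
  simpa using h.clog (by simp)

lemma holFam_expFam (s : ℂ) : HolFam (expFam s) where
  differentiableOn n := by
    cases n with
    | none =>
      change DifferentiableOn ℂ (fun z => Complex.exp (-(Complex.I * z))) _
      fun_prop
    | some n =>
      have h := (differentiable_rotScale n).differentiableOn (s := {z : ℂ | |z.im| < 1})
      exact (((h.const_add 1).clog fun z hz => Or.inl (re_one_add_rotScale_pos hz n)).const_mul _
        |>.add (((h.const_sub 1).clog fun z hz =>
          Or.inl (re_one_sub_rotScale_pos hz n)).const_mul _)).cexp
  tendsto z _ := by
    simp only [expFam, one_sub_rotScale]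
    refine (Complex.continuous_exp.tendsto _).comp ?_
    have h1 := (((tendsto_mul_log_one_add_rotScale z).const_mul (-1 / 2)).add
      ((tendsto_log_one_add_rotScale z).const_mul (-(starRingEnd ℂ) s / 2))).add
      (((tendsto_mul_log_one_add_rotScale (-z)).const_mul (1 / 2)).add
      ((tendsto_log_one_add_rotScale (-z)).const_mul (-s / 2)))
    refine (h1.congr fun n => ?_).trans_eq ?_
    · ring
    · congr 1
      ring
  bound R := by
    refine ⟨Real.exp ((1 + ‖s‖) * (2 * R)), fun n z hz hz' => ?_⟩
    have hR : 0 ≤ R := (norm_nonneg z).trans hz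
    cases n with
    | none =>
      refine (Complex.norm_exp_le_exp_norm _).trans (Real.exp_le_exp.2 ?_)
      rw [norm_neg, norm_mul, Complex.norm_I, one_mul]
      nlinarith [norm_nonneg s]
    | some n =>
      have hN : (1 : ℝ) ≤ (n + 1 : ℕ) := by exact_mod_cast Nat.le_add_left 1 n
      have hl : ∀ w : ℂ, ‖w‖ ≤ R → |w.im| ≤ 1 / 2 →
          ‖Complex.log (1 + rotScale n w)‖ ≤ 2 * R / (n + 1 : ℕ) := fun w hw hw' => by
        refine (norm_log_one_add_le (δ := 1 / 2) (by norm_num) (by norm_num)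
          (le_re_one_add_rotScale (by linarith) n)).trans ?_
        rw [norm_rotScale, div_div_eq_mul_div, div_one, div_mul_eq_mul_div, mul_comm]
        gcongr
      have hc : ∀ a b : ℂ, ‖a‖ = (n + 1 : ℕ) → ‖b‖ = ‖s‖ →
          ‖(a - b) / 2‖ ≤ (n + 1 : ℕ) * (1 + ‖s‖) / 2 := fun a b ha hb => by
        rw [norm_div, Complex.norm_two]
        have := norm_sub_le a b
        rw [ha, hb] at this
        have h2 := mul_le_mul_of_nonneg_right hN (norm_nonneg s)
        gcongr
        linarith
      refine (Complex.norm_exp_le_exp_norm _).trans (Real.exp_le_exp.2 ?_)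
      have h1 := norm_mul_le_of_le (hc (-((n + 1 : ℕ) : ℂ)) ((starRingEnd ℂ) s)
        (by rw [norm_neg, Complex.norm_natCast]) (RCLike.norm_conj s)) (hl z hz hz')
      have h2 := norm_mul_le_of_le (hc ((n + 1 : ℕ) : ℂ) s (Complex.norm_natCast _) rfl)
        (hl (-z) (by rwa [norm_neg]) (by rwa [Complex.neg_im, abs_neg]))
      rw [one_sub_rotScale]
      refine (norm_add_le_of_le h1 h2).trans_eq ?_
      field_simp
      ring

/-- The factor `(1 - iz/N)⁻¹` and its limit `1`. -/
def invFam : Option ℕ → ℂ → ℂ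
  | none, _ => 1
  | some n, z => (1 - rotScale n z)⁻¹

lemma holFam_invFam : HolFam invFam where
  differentiableOn n := by
    cases n with
    | none => exact differentiableOn_const _
    | some n =>
      exact ((differentiable_rotScale n).differentiableOn.const_sub 1).inv fun z hz =>
        Complex.ne_zero_of_re_pos (re_one_sub_rotScale_pos hz n)
  tendsto z _ := by
    have := ((tendsto_rotScale z).const_sub 1).inv₀ (by simp)
    simpa [invFam] using this
  bound R := by
    refine ⟨2, fun n z _ hz' => ?_⟩
    cases n with
    | none => simp [invFam]
    | some n =>
      rw [invFam, norm_inv, inv_le_comm₀ (norm_pos_iff.2 (Complex.ne_zero_of_re_pos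
        (re_one_sub_rotScale_pos (by linarith) n))) two_pos]
      have := le_re_one_sub_rotScale (δ := 1 / 2) (z := z) (by linarith) n
      exact le_trans (by linarith) (Complex.re_le_norm _)

lemma twoF1neg_eq_tsum (m : ℕ) (b c z : ℂ) :
    twoF1neg m b c z = ∑' k : ℕ, poch b k / (poch c k * k.factorial) *
      ∏ i ∈ Finset.range k, ((-(m : ℂ) + i) * z) := by
  rw [tsum_eq_sum (s := Finset.range (m + 1))]
  · refine Finset.sum_congr rfl fun k _ => ?_
    rw [Finset.prod_mul_distrib, Finset.prod_const, Finset.card_range, poch, poch, poch]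
    ring
  · intro k hk
    rw [Finset.prod_eq_zero (i := m), mul_zero]
    · simpa using hk
    · simp

lemma norm_prod_neg_natCast_add_mul_le (m k : ℕ) (z : ℂ) :
    ‖∏ i ∈ Finset.range k, ((-(m : ℂ) + i) * z)‖ ≤ (m * ‖z‖) ^ k := by
  rcases lt_or_ge m k with h | h
  · rw [Finset.prod_eq_zero (i := m) (by simpa using h) (by simp), norm_zero]
    positivity
  · rw [norm_prod]
    refine (Finset.prod_le_prod (fun _ _ => norm_nonneg _) fun i hi => ?_).trans_eq
      (by rw [Finset.prod_const, Finset.card_range])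
    have hi' : i ≤ m := (Finset.mem_range.1 hi).le.trans h
    rw [norm_mul]
    gcongr
    rw [neg_add_eq_sub, ← Complex.ofReal_natCast, ← Complex.ofReal_natCast, ← Complex.ofReal_sub,
      Complex.norm_real, Real.norm_eq_abs, abs_le]
    have : (i : ℝ) ≤ m := by exact_mod_cast hi'
    constructor <;> linarith [i.cast_nonneg (α := ℝ)]

lemma norm_poch_div_le (b : ℂ) {c : ℝ} (hc : 0 < c) (k : ℕ) :
    ‖poch b k / (poch c k * k.factorial)‖ ≤ (‖b‖ / c + 1) ^ k / k.factorial := by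
  rw [← div_div, norm_div, Complex.norm_natCast]
  gcongr
  rw [poch, poch, ← Finset.prod_div_distrib, norm_prod]
  refine (Finset.prod_le_prod (fun _ _ => norm_nonneg _) fun i _ => ?_).trans_eq
    (by rw [Finset.prod_const, Finset.card_range])
  have hi : (0 : ℝ) ≤ i := i.cast_nonneg
  have hn : ‖(c : ℂ) + i‖ = c + i := by
    rw [← Complex.ofReal_natCast, ← Complex.ofReal_add, Complex.norm_real,
      Real.norm_of_nonneg (by positivity)]
  rw [norm_div, hn, div_le_iff₀ (by positivity)]
  refine (norm_add_le _ _).trans ?_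
  rw [Complex.norm_natCast, add_mul, one_mul, mul_add, div_mul_cancel₀ _ hc.ne']
  have : 0 ≤ ‖b‖ / c * i := by positivity
  linarith

lemma norm_hypergeometric_term_le (b : ℂ) {c : ℝ} (hc : 0 < c) {k : ℕ} {P : ℂ} {T : ℝ}
    (hP : ‖P‖ ≤ T ^ k) :
    ‖poch b k / (poch c k * k.factorial) * P‖ ≤ ((‖b‖ / c + 1) * T) ^ k / k.factorial := by
  refine (norm_mul_le_of_le (norm_poch_div_le b hc k) hP).trans_eq ?_
  rw [mul_pow]
  ring

lemma norm_tsum_le_exp (b : ℂ) {c : ℝ} (hc : 0 < c) {P : ℕ → ℂ} {T : ℝ}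
    (hP : ∀ k, ‖P k‖ ≤ T ^ k) :
    ‖∑' k : ℕ, poch b k / (poch c k * k.factorial) * P k‖ ≤ Real.exp ((‖b‖ / c + 1) * T) := by
  refine tsum_of_norm_bounded ?_ fun k => norm_hypergeometric_term_le b hc (hP k)
  rw [Real.exp_eq_exp_ℝ]
  exact NormedSpace.expSeries_div_hasSum_exp _

lemma differentiable_oneF1 (b : ℂ) {c : ℝ} (hc : 0 < c) : Differentiable ℂ (oneF1 b c) := by
  intro z
  have h : DifferentiableOn ℂ (oneF1 b c) (Metric.ball 0 (‖z‖ + 1)) :=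
    differentiableOn_tsum_of_summable_norm
      (Real.summable_pow_div_factorial ((‖b‖ / c + 1) * (‖z‖ + 1)))
      (fun k => by fun_prop) Metric.isOpen_ball fun k w hw =>
      norm_hypergeometric_term_le b hc <| by
        rw [norm_pow]
        gcongr
        exact (mem_ball_zero_iff.1 hw).le
  exact h.differentiableAt (Metric.isOpen_ball.mem_nhds (by simp))

/-- The terminating series `₂F₁[-m, b; c; -2w/(1 - w)]` with `w = iz/N`, and its limit
`₁F₁[b; c; 2iz]`. -/
def hypFam (m : ℕ → ℕ) (b : ℂ) (c : ℝ) : Option ℕ → ℂ → ℂ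
  | none, z => oneF1 b c (2 * Complex.I * z)
  | some n, z => twoF1neg (m n) b c (-2 * rotScale n z / (1 - rotScale n z))

lemma mul_norm_moebius_rotScale_le {m : ℕ → ℕ} (hm : ∀ n, m n ≤ n + 1) {δ : ℝ} (hδ : 0 < δ)
    {z : ℂ} (hz : |z.im| ≤ 1 - δ) (n : ℕ) :
    m n * ‖-2 * rotScale n z / (1 - rotScale n z)‖ ≤ 2 * ‖z‖ / δ := by
  have h1 : δ ≤ ‖1 - rotScale n z‖ := (le_re_one_sub_rotScale hz n).trans (Complex.re_le_norm _)
  have h2 : (m n : ℝ) ≤ (n + 1 : ℕ) := by exact_mod_cast hm n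
  rw [norm_div, norm_mul, norm_neg, Complex.norm_two, norm_rotScale, ← mul_div_assoc]
  refine div_le_div₀ (by positivity) ?_ hδ h1
  calc (m n : ℝ) * (2 * (‖z‖ / (n + 1 : ℕ))) ≤ (n + 1 : ℕ) * (2 * (‖z‖ / (n + 1 : ℕ))) := by gcongr
    _ = 2 * ‖z‖ := by field_simp

lemma holFam_hypFam {m : ℕ → ℕ} (hm : ∀ n, m n ≤ n + 1)
    (hm' : Tendsto (fun n => (m n : ℂ) / ((n + 1 : ℕ) : ℂ)) atTop (nhds 1)) (b : ℂ) {c : ℝ}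
    (hc : 0 < c) : HolFam (hypFam m b c) where
  differentiableOn n := by
    cases n with
    | none =>
      exact ((differentiable_oneF1 b hc).comp (by fun_prop : Differentiable ℂ fun z : ℂ =>
        2 * Complex.I * z)).differentiableOn
    | some n =>
      have h1 := (differentiable_rotScale n).differentiableOn (s := {z : ℂ | |z.im| < 1})
      have h2 := (h1.const_mul (-2)).div (h1.const_sub 1) fun z hz =>
        Complex.ne_zero_of_re_pos (re_one_sub_rotScale_pos hz n)
      change DifferentiableOn ℂ (fun z => twoF1neg (m n) b c _) _
      unfold twoF1neg
      exact DifferentiableOn.fun_sum fun k _ => (h2.pow k).const_mul _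
  tendsto z hz := by
    simp only [hypFam, twoF1neg_eq_tsum, oneF1]
    have hδ : 0 < 1 - |z.im| := sub_pos.2 hz
    refine tendsto_tsum_of_dominated_convergence
      (Real.summable_pow_div_factorial ((‖b‖ / c + 1) * (2 * ‖z‖ / (1 - |z.im|)))) (fun k => ?_)
      (.of_forall fun n k => norm_hypergeometric_term_le b hc ?_)
    · refine Tendsto.const_mul _ ?_
      rw [← Finset.card_range k, ← Finset.prod_const, Finset.card_range]
      refine tendsto_finsetProd _ fun i _ => ?_
      have h1 : Tendsto (fun n : ℕ => (i : ℂ) / ((n + 1 : ℕ) : ℂ)) atTop (nhds 0) :=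
        (tendsto_const_div_atTop_nhds_zero_nat (i : ℂ)).comp (tendsto_add_atTop_nat 1)
      have h2 := ((tendsto_rotScale z).const_sub 1).inv₀ (by simp)
      have h3 := ((hm'.sub h1).mul_const (2 * Complex.I * z)).mul h2
      refine (h3.congr fun n => ?_).trans_eq (by simp)
      have hn : (((n + 1 : ℕ) : ℂ)) ≠ 0 := Nat.cast_ne_zero.2 n.succ_ne_zero
      have hw := mul_rotScale n z
      rw [show 2 * Complex.I * z = 2 * (((n + 1 : ℕ) : ℂ) * rotScale n z) by rw [hw]; ring]
      field_simp
      ring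
    · refine (norm_prod_neg_natCast_add_mul_le _ _ _).trans ?_
      gcongr
      exact mul_norm_moebius_rotScale_le hm hδ (by linarith) n
  bound R := by
    refine ⟨Real.exp ((‖b‖ / c + 1) * (4 * R)), fun n z hz hz' => ?_⟩
    cases n with
    | none =>
      refine norm_tsum_le_exp b hc fun k => ?_
      rw [norm_pow, norm_mul, norm_mul, Complex.norm_I, Complex.norm_two]
      gcongr
      linarith [(norm_nonneg z).trans hz]
    | some n =>
      rw [hypFam, twoF1neg_eq_tsum]
      refine norm_tsum_le_exp b hc fun k => (norm_prod_neg_natCast_add_mul_le _ _ _).trans ?_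
      refine pow_le_pow_left₀ (by positivity) ?_ k
      refine (mul_norm_moebius_rotScale_le hm (δ := 1 / 2) (z := z) (by norm_num)
        (by linarith) n).trans ?_
      linarith

/-- The holomorphic family underlying `p̃_N` and `P̃`. -/
def fFam (s : ℂ) (n : Option ℕ) (z : ℂ) : ℂ :=
  expFam s n z * hypFam (fun n => n + 1) s (2 * s.re + 1) n z

/-- The holomorphic family underlying `p_{N-1}` and `Q`. -/
def gFam (s : ℂ) (n : Option ℕ) (z : ℂ) : ℂ :=
  z * invFam n z * (expFam s n z * hypFam (fun n => n) (s + 1) (2 * s.re + 2) n z)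

lemma smoothFam_fFam {s : ℂ} (hs : -(1 / 2 : ℝ) < s.re) :
    SmoothFam fun n (u : ℝ) => fFam s n u := by
  refine ((holFam_expFam s).mul (holFam_hypFam (fun n => le_rfl) ?_ s (by linarith))).smoothFam
  refine tendsto_const_nhds.congr fun n => (div_self ?_).symm
  exact Nat.cast_ne_zero.2 n.succ_ne_zero

lemma smoothFam_gFam {s : ℂ} (hs : -(1 / 2 : ℝ) < s.re) :
    SmoothFam fun n (u : ℝ) => gFam s n u := by
  refine ((HolFam.id.mul holFam_invFam).mul ((holFam_expFam s).mul
    (holFam_hypFam (fun n => n.le_succ) ?_ (s + 1) (by linarith)))).smoothFam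
  simpa using tendsto_natCast_div_add_atTop (1 : ℂ)

lemma arg_one_add_I_mul (t : ℝ) : Complex.arg (1 + Complex.I * t) = Real.arctan t := by
  have h : ‖1 + Complex.I * (t : ℂ)‖ = √(1 + t ^ 2) := by
    rw [Complex.norm_eq_sqrt_sq_add_sq]
    simp
  rw [Complex.arg_of_re_nonneg (by simp), Real.arctan_eq_arcsin, h]
  simp

lemma log_one_add_I_mul (t : ℝ) : Complex.log (1 + Complex.I * t) =
    ((Real.log (1 + t ^ 2) / 2 : ℝ) : ℂ) + Real.arctan t * Complex.I := by
  have h : ‖1 + Complex.I * (t : ℂ)‖ = √(1 + t ^ 2) := by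
    rw [Complex.norm_eq_sqrt_sq_add_sq]
    simp
  rw [Complex.log, arg_one_add_I_mul, h, Real.log_sqrt (by positivity)]

lemma arctan_eq_sign_sub {y : ℝ} (hy : y ≠ 0) :
    Real.arctan y = Real.pi / 2 * Real.sign y - Real.arctan y⁻¹ := by
  rcases hy.lt_or_gt with h | h
  · rw [Real.arctan_inv_of_neg h, Real.sign_of_neg h]; ring
  · rw [Real.arctan_inv_of_pos h, Real.sign_of_pos h]; ring

lemma sqrt_wH (s : ℂ) (N : ℕ) {y : ℝ} (hy : y ≠ 0) :
    √(wH s N y) = |y| ^ (-s.re) * (|y| ^ N)⁻¹ *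
      Real.exp (-(s.re + N) * (Real.log (1 + y⁻¹ ^ 2) / 2) +
        s.im * (Real.pi / 2 * Real.sign y - Real.arctan y⁻¹)) := by
  have hy' : 0 < |y| := abs_pos.2 hy
  have h1 : Real.log (1 + y ^ 2) = 2 * Real.log |y| + Real.log (1 + y⁻¹ ^ 2) := by
    rw [← sq_abs y, ← Real.log_rpow hy', ← Real.log_mul (by positivity) (by positivity)]
    congr 1
    rw [inv_pow, ← sq_abs y, Real.rpow_two]
    field_simp
    ring
  rw [wH, arg_one_add_I_mul, Real.rpow_def_of_pos (by positivity), ← Real.exp_add, ← Real.exp_half,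
    ← Real.rpow_natCast |y| N, ← Real.rpow_neg hy'.le, Real.rpow_def_of_pos hy',
    Real.rpow_def_of_pos hy', ← Real.exp_add, ← Real.exp_add, h1, ← arctan_eq_sign_sub hy]
  congr 1
  ring

/-- The locally constant factor `Sgn(x)^N e^{π Im(s) Sgn(x)/2}`, with `N = 0` at `none`. -/
def signWeight (s : ℂ) : Option ℕ → ℝ → ℂ
  | none, x => Real.exp (Real.pi / 2 * s.im * Real.sign x)
  | some n, x => (Real.sign x : ℂ) ^ (n + 1) * Real.exp (Real.pi / 2 * s.im * Real.sign x)

lemma locConst_signWeight (s : ℂ) (n : Option ℕ) : LocConst (signWeight s n) := by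
  cases n with
  | none => exact locConst_of_sign fun r => Real.exp (Real.pi / 2 * s.im * r)
  | some n =>
    exact locConst_of_sign fun r => (r : ℂ) ^ (n + 1) * Real.exp (Real.pi / 2 * s.im * r)

lemma pow_mul_sqrt_wH (s : ℂ) (n : ℕ) {x : ℝ} (hx : x ≠ 0) :
    ((((n + 1 : ℕ) * x : ℝ) : ℂ) - Complex.I) ^ (n + 1) * (√(wH s (n + 1) ((n + 1 : ℕ) * x)) : ℂ) =
      signWeight s (some n) x * ((|(n + 1 : ℕ) * x| ^ (-s.re) : ℝ) : ℂ) *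
        expFam s (some n) (x⁻¹ : ℝ) := by
  have hN : (0 : ℝ) < (n + 1 : ℕ) := Nat.cast_pos.2 n.succ_pos
  set y : ℝ := (n + 1 : ℕ) * x with hy_def
  have hy : y ≠ 0 := mul_ne_zero hN.ne' hx
  have hsy : Real.sign y = Real.sign x := by
    rcases hx.lt_or_gt with h | h
    · rw [Real.sign_of_neg h, Real.sign_of_neg (mul_neg_of_pos_of_neg hN h)]
    · rw [Real.sign_of_pos h, Real.sign_of_pos (mul_pos hN h)]
  have hw : rotScale n (x⁻¹ : ℝ) = Complex.I * (y⁻¹ : ℝ) := by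
    rw [rotScale, hy_def]
    push_cast
    rw [mul_inv]
    ring
  have hw' : 1 - rotScale n (x⁻¹ : ℝ) = 1 + Complex.I * ((-y⁻¹ : ℝ) : ℂ) := by
    rw [hw]
    push_cast
    ring
  have hyC : (y : ℂ) ≠ 0 := Complex.ofReal_ne_zero.2 hy
  have hne : 1 + Complex.I * ((-y⁻¹ : ℝ) : ℂ) ≠ 0 := Complex.ne_zero_of_re_pos (by simp)
  have hpow : ((y : ℂ) - Complex.I) ^ (n + 1) = (Real.sign x : ℂ) ^ (n + 1) *
      ((|y| ^ (n + 1) : ℝ) : ℂ) *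
        Complex.exp ((n + 1 : ℕ) * Complex.log (1 + Complex.I * ((-y⁻¹ : ℝ) : ℂ))) := by
    rw [Complex.exp_nat_mul, Complex.exp_log hne, Complex.ofReal_pow, ← mul_pow, ← mul_pow,
      ← hsy, ← Complex.ofReal_mul, show Real.sign y * |y| = y from by
        rw [abs_eq_sign_mul, ← mul_assoc, sign_mul_self_of_ne_zero hy, one_mul]]
    congr 1
    push_cast
    field_simp
    ring
  rw [hpow, sqrt_wH s _ hy, expFam, hw', hw, signWeight, hsy, log_one_add_I_mul, log_one_add_I_mul,
    Real.arctan_neg, neg_sq]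
  have hc : ((|y| ^ (n + 1) : ℝ) : ℂ) ≠ 0 := Complex.ofReal_ne_zero.2 (by positivity)
  have hs : s = s.re + s.im * Complex.I := (Complex.re_add_im s).symm
  have hs' : (starRingEnd ℂ) s = s.re - s.im * Complex.I :=
    Complex.ext (by simp) (by simp)
  generalize Real.log (1 + y⁻¹ ^ 2) = ℓ
  generalize Real.arctan y⁻¹ = θ
  have key : Complex.exp ((n + 1 : ℕ) * (((ℓ / 2 : ℝ) : ℂ) + ((-θ : ℝ) : ℂ) * Complex.I)) *
      (Real.exp (-(s.re + (n + 1 : ℕ)) * (ℓ / 2) +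
        s.im * (Real.pi / 2 * Real.sign x - θ)) : ℂ) =
      (Real.exp (Real.pi / 2 * s.im * Real.sign x) : ℂ) *
      Complex.exp ((-((n + 1 : ℕ) : ℂ) - (starRingEnd ℂ) s) / 2 *
          (((ℓ / 2 : ℝ) : ℂ) + θ * Complex.I) + (((n + 1 : ℕ) : ℂ) - s) / 2 *
          (((ℓ / 2 : ℝ) : ℂ) + ((-θ : ℝ) : ℂ) * Complex.I)) := by
    rw [Complex.ofReal_exp, Complex.ofReal_exp, ← Complex.exp_add, ← Complex.exp_add, hs']
    congr 1
    push_cast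
    linear_combination (ℓ / 4 - θ * Complex.I / 2) * hs - (s.im * θ) * Complex.I_sq
  rw [Complex.ofReal_mul, Complex.ofReal_mul, Complex.ofReal_inv]
  rw [show ∀ a b c d e f : ℂ, a * b * c * (d * e * f) = a * d * (b * e) * (c * f) by
    intros; ring, mul_inv_cancel₀ hc, key]
  ring

/-- `φ̂_N(x) = N^σ φ_N(N x)`, with limit `2^(-σ) P̃`. -/
def phiHat (s : ℂ) : Option ℕ → ℝ → ℂ
  | none, x => (((2 : ℝ) ^ (-s.re) : ℝ) : ℂ) * Ptilde s (1 * x)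
  | some n, x => ((((n + 1 : ℕ) : ℝ) ^ s.re : ℝ) : ℂ) * phiN s (n + 1) ((n + 1 : ℕ) * x)

/-- `ψ̂_N(x) = N^(σ+1) ψ_N(N x)`, with limit `2^(-σ-1) Q`. -/
def psiHat (s : ℂ) : Option ℕ → ℝ → ℂ
  | none, x => (((2 : ℝ) ^ (-(s.re + 1)) : ℝ) : ℂ) * Qfun s (1 * x)
  | some n, x => ((((n + 1 : ℕ) : ℝ) ^ (s.re + 1) : ℝ) : ℂ) * psiN s (n + 1) ((n + 1 : ℕ) * x)

lemma two_rpow_mul_prefac (s : ℂ) {x : ℝ} (hx : x ≠ 0) :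
    (((2 : ℝ) ^ (-s.re) : ℝ) : ℂ) * prefac s x =
      signWeight s none x * ((|x| ^ (-s.re) : ℝ) : ℂ) * expFam s none (x⁻¹ : ℝ) := by
  have h : (2 : ℝ) ^ (-s.re) * |2 / x| ^ s.re = |x| ^ (-s.re) := by
    rw [abs_div, abs_two, Real.div_rpow two_pos.le (abs_nonneg x), Real.rpow_neg two_pos.le,
      Real.rpow_neg (abs_nonneg x)]
    field_simp
  rw [prefac, ← mul_assoc, ← Complex.ofReal_mul, h, Complex.exp_add, signWeight, expFam,
    Complex.ofReal_exp]
  push_cast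
  ring_nf

lemma two_div_one_add_I_mul (n : ℕ) {x : ℝ} (hx : x ≠ 0) :
    2 / (1 + Complex.I * (((n + 1 : ℕ) * x : ℝ) : ℂ)) =
      -2 * rotScale n (x⁻¹ : ℝ) / (1 - rotScale n (x⁻¹ : ℝ)) := by
  have hN : (((n + 1 : ℕ) : ℂ)) ≠ 0 := Nat.cast_ne_zero.2 n.succ_ne_zero
  have hxC : (x : ℂ) ≠ 0 := Complex.ofReal_ne_zero.2 hx
  have h1 : 1 - rotScale n (x⁻¹ : ℝ) ≠ 0 :=
    Complex.ne_zero_of_re_pos (re_one_sub_rotScale_pos (by simp) n)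
  have h2 : 1 + Complex.I * (((n + 1 : ℕ) * x : ℝ) : ℂ) ≠ 0 :=
    Complex.ne_zero_of_re_pos (by simp)
  rw [div_eq_div_iff h2 h1, rotScale]
  push_cast at hN ⊢
  field_simp
  linear_combination (x * (n + 1) : ℂ) * Complex.I_sq

lemma natCast_mul_inv_sub_I (n : ℕ) {x : ℝ} (hx : x ≠ 0) :
    ((n + 1 : ℕ) : ℂ) * ((((n + 1 : ℕ) * x : ℝ) : ℂ) - Complex.I)⁻¹ =
      (x⁻¹ : ℝ) * invFam (some n) (x⁻¹ : ℝ) := by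
  have hN : (((n + 1 : ℕ) : ℂ)) ≠ 0 := Nat.cast_ne_zero.2 n.succ_ne_zero
  have hxC : (x : ℂ) ≠ 0 := Complex.ofReal_ne_zero.2 hx
  have h : (((n + 1 : ℕ) * x : ℝ) : ℂ) - Complex.I =
      ((n + 1 : ℕ) : ℂ) * x * (1 - rotScale n (x⁻¹ : ℝ)) := by
    rw [rotScale]
    push_cast at hN ⊢
    field_simp
  rw [h, invFam, mul_inv, mul_inv]
  push_cast at hN ⊢
  field_simp

lemma natCast_rpow_mul_abs_rpow_neg (n : ℕ) (x σ : ℝ) :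
    ((n + 1 : ℕ) : ℝ) ^ σ * |(n + 1 : ℕ) * x| ^ (-σ) = |x| ^ (-σ) := by
  have hN : (0 : ℝ) < (n + 1 : ℕ) := Nat.cast_pos.2 n.succ_pos
  rw [abs_mul, abs_of_pos hN, Real.mul_rpow hN.le (abs_nonneg x), ← mul_assoc, ← Real.rpow_add hN,
    add_neg_cancel, Real.rpow_zero, one_mul]

lemma phiHat_eq (s : ℂ) (n : Option ℕ) {x : ℝ} (hx : x ≠ 0) :
    phiHat s n x = signWeight s n x * ((|x| ^ (-s.re) : ℝ) : ℂ) * fFam s n (x⁻¹ : ℝ) := by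
  cases n with
  | none =>
    rw [phiHat, one_mul, Ptilde, ← mul_assoc, two_rpow_mul_prefac s hx, fFam, hypFam,
      Complex.ofReal_inv, ← div_eq_mul_inv]
    ring
  | some n =>
    rw [phiHat, phiN, pTil, two_div_one_add_I_mul n hx, mul_right_comm, pow_mul_sqrt_wH s n hx,
      ← natCast_rpow_mul_abs_rpow_neg n x s.re, fFam, hypFam, Complex.ofReal_mul]
    ring

lemma psiHat_eq (s : ℂ) (n : Option ℕ) {x : ℝ} (hx : x ≠ 0) :
    psiHat s n x = signWeight s n x * ((|x| ^ (-s.re) : ℝ) : ℂ) * gFam s n (x⁻¹ : ℝ) := by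
  cases n with
  | none =>
    have h : (((2 : ℝ) ^ (-(s.re + 1)) : ℝ) : ℂ) * (2 / (x : ℂ)) =
        (((2 : ℝ) ^ (-s.re) : ℝ) : ℂ) * (x⁻¹ : ℝ) := by
      rw [neg_add, Real.rpow_add two_pos, Real.rpow_neg_one]
      push_cast
      ring
    rw [psiHat, one_mul, Qfun, ← mul_assoc, ← mul_assoc, h, mul_right_comm _ _ (prefac s x),
      two_rpow_mul_prefac s hx, gFam, invFam, hypFam, Complex.ofReal_inv, ← div_eq_mul_inv (2 * _)]
    ring
  | some n =>
    have hN : (0 : ℝ) < (n + 1 : ℕ) := Nat.cast_pos.2 n.succ_pos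
    have hne : (((n + 1 : ℕ) * x : ℝ) : ℂ) - Complex.I ≠ 0 := by
      intro h
      simpa using congrArg Complex.im h
    have h := natCast_mul_inv_sub_I n hx
    have h' := pow_mul_sqrt_wH s n hx
    have hp : ((((n + 1 : ℕ) * x : ℝ) : ℂ) - Complex.I) ^ n =
        ((((n + 1 : ℕ) * x : ℝ) : ℂ) - Complex.I) ^ (n + 1) *
          ((((n + 1 : ℕ) * x : ℝ) : ℂ) - Complex.I)⁻¹ := by
      rw [pow_succ, mul_inv_cancel_right₀ hne]
    rw [psiHat, psiN, pPrev, two_div_one_add_I_mul n hx, Nat.add_sub_cancel, hp,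
      Real.rpow_add_one hN.ne', ← natCast_rpow_mul_abs_rpow_neg n x s.re, gFam, ← h, hypFam,
      Complex.ofReal_mul (_ ^ s.re) ((n + 1 : ℕ) : ℝ),
      Complex.ofReal_mul (_ ^ s.re) (_ ^ (-s.re)), Complex.ofReal_natCast,
      show ∀ a b c d e f : ℂ, a * b * (c * d * e * f) = c * f * (a * b * d * e) by
      intros; ring, h']
    ring

lemma Gamma_add_natCast_succ {a : ℝ} (ha : 0 < a) (n : ℕ) :
    Real.Gamma (a + n) = (∏ j ∈ Finset.range n, (a + j)) * Real.Gamma a := by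
  induction n with
  | zero => simp
  | succ n ih =>
    rw [Finset.prod_range_succ, Nat.cast_succ, ← add_assoc, Real.Gamma_add_one (by positivity), ih]
    ring

lemma tendsto_Gamma_add_div_Gamma {a : ℝ} (ha : 0 < a) :
    Tendsto (fun n : ℕ => Real.Gamma (a + (n + 1 : ℕ)) / Real.Gamma (n + 1 : ℕ) *
      ((n + 1 : ℕ) : ℝ) ^ (-a)) atTop (nhds 1) := by
  have hΓ : 0 < Real.Gamma a := Real.Gamma_pos_of_pos ha
  have h1 := (Real.GammaSeq_tendsto_Gamma a).inv₀ hΓ.ne'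
  have h2 : Tendsto (fun n : ℕ => ((n : ℝ) / (n + 1 : ℝ)) ^ a) atTop (nhds 1) := by
    simpa using (tendsto_natCast_div_add_atTop (1 : ℝ)).rpow_const (p := a) (Or.inl one_ne_zero)
  have h3 := (h1.const_mul (Real.Gamma a)).mul h2
  rw [mul_inv_cancel₀ hΓ.ne', one_mul] at h3
  refine h3.congr' ?_
  filter_upwards [eventually_gt_atTop 0] with n hn
  have hn' : (0 : ℝ) < n := Nat.cast_pos.2 hn
  have hp : 0 < ∏ j ∈ Finset.range (n + 1), (a + j) := Finset.prod_pos fun j _ => by positivity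
  have hf : (0 : ℝ) < n.factorial := Nat.cast_pos.2 n.factorial_pos
  rw [Gamma_add_natCast_succ ha, Real.GammaSeq, Nat.cast_succ, Real.Gamma_nat_eq_factorial,
    Real.div_rpow hn'.le (by positivity), Real.rpow_neg (by positivity)]
  have : (0 : ℝ) < (n + 1 : ℝ) ^ a := by positivity
  have : (0 : ℝ) < (n : ℝ) ^ a := by positivity
  field_simp

/-- The constants in front of the normalized kernels. -/
def kernelConst (s : ℂ) : Option ℕ → ℂ
  | none => cinf s * (((2 : ℝ) ^ (2 * s.re + 1) : ℝ) : ℂ)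
  | some n => CNs s (n + 1) * ((((n + 1 : ℕ) : ℝ) ^ (-(2 * s.re + 1)) : ℝ) : ℂ)

lemma tendsto_kernelConst {s : ℂ} (hs : -(1 / 2 : ℝ) < s.re) :
    Tendsto (fun n => kernelConst s (some n)) atTop (nhds (kernelConst s none)) := by
  have h := (Complex.continuous_ofReal.tendsto _).comp
    (tendsto_Gamma_add_div_Gamma (a := 2 * s.re + 1) (by linarith))
  have h' := h.const_mul (kernelConst s none)
  rw [Complex.ofReal_one, mul_one] at h'
  refine h'.congr fun n => ?_
  rw [Function.comp_apply, kernelConst, kernelConst, cinf, CNs, Complex.ofReal_mul,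
    Complex.ofReal_div (Real.Gamma _), ← Complex.Gamma_ofReal, ← Complex.Gamma_ofReal,
    Complex.ofReal_natCast, Real.rpow_add_one two_ne_zero, add_right_comm]
  push_cast
  field_simp

lemma wronskian_quotient_comp_mul_left {φ ψ : ℝ → ℂ} {r : ℝ} (hr : r ≠ 0) (a b : ℂ) (x y : ℝ) :
    (if x = y then deriv (fun x => a * φ (r * x)) x * (b * ψ (r * x)) -
        deriv (fun x => b * ψ (r * x)) x * (a * φ (r * x))
      else (a * φ (r * x) * (b * ψ (r * y)) - b * ψ (r * x) * (a * φ (r * y))) /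
        ((x : ℂ) - (y : ℂ))) =
    a * b * (r * (if r * x = r * y then deriv φ (r * x) * ψ (r * x) - deriv ψ (r * x) * φ (r * x)
      else (φ (r * x) * ψ (r * y) - ψ (r * x) * φ (r * y)) /
        (((r * x : ℝ) : ℂ) - ((r * y : ℝ) : ℂ)))) := by
  simp only [mul_right_inj' hr]
  split_ifs with h
  · rw [deriv_const_mul_field, deriv_const_mul_field, deriv_comp_mul_left, deriv_comp_mul_left,
      Complex.real_smul, Complex.real_smul]
    ring
  · have hr' : (r : ℂ) ≠ 0 := Complex.ofReal_ne_zero.2 hr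
    have hxy : (x : ℂ) - y ≠ 0 := by
      rw [← Complex.ofReal_sub, Complex.ofReal_ne_zero]
      exact sub_ne_zero.2 h
    rw [Complex.ofReal_mul, Complex.ofReal_mul, ← mul_sub]
    field_simp

/-- The kernels `K_[N]` for `N = n + 1`, together with their limit `K_∞`. -/
def kernelFam (s : ℂ) : Option ℕ → ℝ → ℝ → ℝ
  | none => Kinf s
  | some n => Kscaled s (n + 1)

lemma kernelFam_eq (s : ℂ) (n : Option ℕ) (x y : ℝ) :
    kernelFam s n x y = (kernelConst s n *
      (if x = y then deriv (phiHat s n) x * psiHat s n x - deriv (psiHat s n) x * phiHat s n x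
        else (phiHat s n x * psiHat s n y - psiHat s n x * phiHat s n y) /
          ((x : ℂ) - (y : ℂ)))).re := by
  cases n with
  | none =>
    have h := wronskian_quotient_comp_mul_left (φ := Ptilde s) (ψ := Qfun s) one_ne_zero
      (((2 : ℝ) ^ (-s.re) : ℝ) : ℂ) (((2 : ℝ) ^ (-(s.re + 1)) : ℝ) : ℂ) x y
    refine Eq.trans ?_ (congrArg (fun w => (kernelConst s none * w).re) h.symm)
    have hc : kernelConst s none *
        ((((2 : ℝ) ^ (-s.re) : ℝ) : ℂ) * (((2 : ℝ) ^ (-(s.re + 1)) : ℝ) : ℂ)) = cinf s := by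
      rw [kernelConst, mul_assoc, ← Complex.ofReal_mul, ← Complex.ofReal_mul,
        ← Real.rpow_add two_pos, ← Real.rpow_add two_pos,
        show 2 * s.re + 1 + (-s.re + -(s.re + 1)) = 0 by ring]
      simp
    rw [← mul_assoc, hc, kernelFam, Kinf, KinfC]
    simp only [one_mul, Complex.ofReal_one, mul_ite, mul_div_assoc]
  | some n =>
    have hN : (0 : ℝ) < (n + 1 : ℕ) := Nat.cast_pos.2 n.succ_pos
    have h := wronskian_quotient_comp_mul_left (φ := phiN s (n + 1)) (ψ := psiN s (n + 1)) hN.ne'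
      ((((n + 1 : ℕ) : ℝ) ^ s.re : ℝ) : ℂ) ((((n + 1 : ℕ) : ℝ) ^ (s.re + 1) : ℝ) : ℂ) x y
    refine Eq.trans ?_ (congrArg (fun w => (kernelConst s (some n) * w).re) h.symm)
    have hc : kernelConst s (some n) * (((((n + 1 : ℕ) : ℝ) ^ s.re : ℝ) : ℂ) *
        ((((n + 1 : ℕ) : ℝ) ^ (s.re + 1) : ℝ) : ℂ)) = CNs s (n + 1) := by
      rw [kernelConst, mul_assoc, ← Complex.ofReal_mul, ← Complex.ofReal_mul,
        ← Real.rpow_add hN, ← Real.rpow_add hN,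
        show -(2 * s.re + 1) + (s.re + (s.re + 1)) = 0 by ring]
      simp
    rw [← mul_assoc, hc, mul_left_comm, Complex.re_ofReal_mul, kernelFam, Kscaled, KN, KNC]
    simp only [mul_ite, mul_div_assoc]

lemma kernelFam_eq_weighted {s : ℂ} (hs : -(1 / 2 : ℝ) < s.re) (n : Option ℕ) (x y : ℝ)
    (hx : x ≠ 0) (hy : y ≠ 0) :
    kernelFam s n x y =
      (signWeight s n x * Real.sign x * ((|x| ^ (-(s.re + 1)) : ℝ) : ℂ) *
        (signWeight s n y * Real.sign y * ((|y| ^ (-(s.re + 1)) : ℝ) : ℂ) *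
          (kernelConst s n * wronskKernel (fun u : ℝ => fFam s n u) (fun u : ℝ => gFam s n u)
            (x⁻¹, y⁻¹)))).re := by
  have hf := ((smoothFam_fFam hs).contDiff n).of_le (m := 1) (by exact_mod_cast le_top)
  have hg := ((smoothFam_gFam hs).contDiff n).of_le (m := 1) (by exact_mod_cast le_top)
  rw [kernelFam_eq, wronskian_quotient_eq (locConst_signWeight s n) hf hg
    (fun x hx => phiHat_eq s n hx) (fun x hx => psiHat_eq s n hx) hx hy]
  congr 1
  ring

lemma admFam_kernel {s : ℂ} (hs : -(1 / 2 : ℝ) < s.re) :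
    AdmFam fun n z => kernelConst s n *
      wronskKernel (fun u : ℝ => fFam s n u) (fun u : ℝ => gFam s n u) z :=
  (AdmFam.const (kernelConst s) (tendsto_kernelConst hs)).mul
    (AdmFam.wronskKernel (smoothFam_fFam hs) (smoothFam_gFam hs))

lemma norm_signWeight_mul_sign_le (s : ℂ) (n : Option ℕ) (x : ℝ) :
    ‖signWeight s n x * Real.sign x‖ ≤ Real.exp (Real.pi / 2 * |s.im|) := by
  have hs : ‖(Real.sign x : ℂ)‖ ≤ 1 := by
    rcases Real.sign_apply_eq x with h | h | h <;> simp [h]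
  have he : ‖(Real.exp (Real.pi / 2 * s.im * Real.sign x) : ℂ)‖ ≤
      Real.exp (Real.pi / 2 * |s.im|) := by
    rw [Complex.norm_real, Real.norm_of_nonneg (Real.exp_pos _).le, mul_assoc]
    gcongr
    refine (le_abs_self _).trans ?_
    rw [abs_mul]
    rw [Complex.norm_real, Real.norm_eq_abs] at hs
    exact mul_le_of_le_one_right (abs_nonneg _) hs
  rw [norm_mul]
  refine (mul_le_of_le_one_right (norm_nonneg _) hs).trans ?_
  cases n with
  | none => exact he
  | some n =>
    rw [signWeight, norm_mul, norm_pow]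
    exact (mul_le_of_le_one_left (norm_nonneg _) (pow_le_one₀ (norm_nonneg _) hs)).trans he

/-- For `Re(s) > −1/2`, the kernels `K_[N]` and `K_∞` are `C^∞` on
`(ℝ∖{0})²`; for all `p, q` and `x, y ≠ 0`,
`Sgn(xy)^N ∂^{p+q}K_[N](x,y) → ∂^{p+q}K_∞(x,y)` as `N → ∞`; and
`|∂^{p+q}K_[N](x,y)| ≤ C(x₀,s,p,q)/(|x|^{Re(s)+p+1}|y|^{Re(s)+q+1})` for `|x|,|y| ≥ x₀`. -/
theorem Kscaled_derivatives_converge (s : ℂ) (hs : -(1 / 2 : ℝ) < s.re) :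
    (∀ N : ℕ, 1 ≤ N →
      ContDiffOn ℝ (⊤ : ℕ∞) (Function.uncurry (Kscaled s N)) ({0}ᶜ ×ˢ {0}ᶜ)) ∧
    ContDiffOn ℝ (⊤ : ℕ∞) (Function.uncurry (Kinf s)) ({0}ᶜ ×ˢ {0}ᶜ) ∧
    (∀ p q : ℕ, ∀ x y : ℝ, x ≠ 0 → y ≠ 0 →
      Filter.Tendsto
        (fun N : ℕ => Real.sign (x * y) ^ N * pderiv₂ (Kscaled s N) p q x y)
        Filter.atTop (nhds (pderiv₂ (Kinf s) p q x y))) ∧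
    ∀ x₀ : ℝ, 0 < x₀ → ∀ p q : ℕ, ∃ C : ℝ, ∀ N : ℕ, 1 ≤ N → ∀ x y : ℝ,
      x₀ ≤ |x| → x₀ ≤ |y| →
      |pderiv₂ (Kscaled s N) p q x y| ≤
        C / (|x| ^ (s.re + (p : ℝ) + 1) * |y| ^ (s.re + (q : ℝ) + 1)) := by
  have hκ : ∀ n, LocConst fun x => signWeight s n x * Real.sign x := fun n =>
    (locConst_signWeight s n).mul (locConst_of_sign fun r => (r : ℂ))
  have hh := admFam_kernel hs
  have hK := kernelFam_eq_weighted hs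
  refine ⟨fun N hN => ?_, contDiffOn_of_weighted hκ hh hK none, fun p q x y hx hy => ?_,
    fun x₀ hx₀ p q => ?_⟩
  · obtain ⟨n, rfl⟩ := Nat.exists_eq_add_of_le' hN
    exact contDiffOn_of_weighted hκ hh hK (some n)
  · rw [← tendsto_add_atTop_iff_nat 1]
    exact tendsto_pderiv₂_of_weighted hκ hh hK
      (fun N x => by rw [signWeight, signWeight, mul_assoc]) p q hx hy
  · obtain ⟨C, hC⟩ := exists_bound_pderiv₂_of_weighted hκ hh hK
      (norm_signWeight_mul_sign_le s) hx₀ p q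
    refine ⟨C, fun N hN x y hx hy => ?_⟩
    obtain ⟨n, rfl⟩ := Nat.exists_eq_add_of_le' hN
    rw [add_right_comm s.re (p : ℝ) 1, add_right_comm s.re (q : ℝ) 1]
    exact hC (some n) x y hx hy
end
end

section
/- Let k ≥ 1 and let F : (0,∞)^{k+1} → ℝ be C¹. Suppose there exist α > 1 and, for every x₀ > 0, a constant C(x₀) such that |F(t,x₁,…,x_k)| + |∂F/∂t (t,x₁,…,x_k)| ≤ C(x₀)/(x₁⋯x_k)^α for all t, x₁,…,x_k ≥ x₀. Then all the integrals below are absolutely convergent, the function H₀(t) = ∫_{(t,∞)^k} F(t,x₁,…,x_k) dx₁⋯dx_k is continuously differentiable on (0,∞), and its derivative equals H₁(t) = ∫_{(t,∞)^k} ∂F/∂t (t,x₁,…,x_k) dx₁⋯dx_k − ∑_{l=1}^k ∫_{(t,∞)^{k−1}} F(t,x₁,…,x_{l−1},t,x_{l+1},…,x_k) dx₁⋯dx_{l−1}dx_{l+1}⋯dx_k. -/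
noncomputable section

open Complex MeasureTheory Filter Set

/-- `H₀(t) = ∫_{(t,∞)^k} F(t,x) dx`. -/
def H0 (k : ℕ) (F : ℝ → (Fin k → ℝ) → ℝ) (t : ℝ) : ℝ :=
  ∫ x : Fin k → ℝ in Set.univ.pi fun _ => Set.Ioi t, F t x

/-- `H₁(t) = ∫_{(t,∞)^k} ∂F/∂t dx − ∑_l ∫_{(t,∞)^{k−1}} F(t,…,t,…) dx`. -/
def H1 (k : ℕ) (F : ℝ → (Fin k → ℝ) → ℝ) (t : ℝ) : ℝ :=
  (∫ x : Fin k → ℝ in Set.univ.pi fun _ => Set.Ioi t, deriv (fun t' => F t' x) t) -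
    ∑ l : Fin k, ∫ y : { i : Fin k // i ≠ l } → ℝ in Set.univ.pi fun _ => Set.Ioi t,
      F t fun i => if hi : i = l then t else y ⟨i, hi⟩

/-- The open orthant `(t, ∞)^ι`. -/
abbrev orthant (ι : Type*) (t : ℝ) : Set (ι → ℝ) := Set.univ.pi fun _ => Set.Ioi t

/-- A jointly continuous family of functions on the positive orthant which is dominated,
locally uniformly in the parameter, by a multiple of `(∏ i, x i)⁻ᵅ`. -/
structure DominatedFamily {ι : Type*} [Fintype ι] (α : ℝ) (f : ℝ → (ι → ℝ) → ℝ) : Prop where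
  continuousOn : ContinuousOn (fun p : ℝ × (ι → ℝ) => f p.1 p.2) (Set.Ioi 0 ×ˢ orthant ι 0)
  bound : ∀ x₀ : ℝ, 0 < x₀ → ∃ C : ℝ, ∀ t : ℝ, ∀ x : ι → ℝ,
    x₀ ≤ t → (∀ i, x₀ ≤ x i) → |f t x| ≤ C / (∏ i, x i) ^ α

section

variable {ι : Type*} [Fintype ι] {α : ℝ} {f : ℝ → (ι → ℝ) → ℝ}

lemma mem_orthant {ι : Type*} {t : ℝ} {x : ι → ℝ} : x ∈ orthant ι t ↔ ∀ i, t < x i := by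
  simp [orthant]

lemma measurableSet_orthant (t : ℝ) : MeasurableSet (orthant ι t) :=
  MeasurableSet.univ_pi fun _ => measurableSet_Ioi

lemma isOpen_orthant (t : ℝ) : IsOpen (orthant ι t) :=
  isOpen_set_pi Set.finite_univ fun _ _ => isOpen_Ioi

lemma orthant_mono {ι : Type*} {s t : ℝ} (h : s ≤ t) : orthant ι t ⊆ orthant ι s :=
  Set.pi_mono fun _ _ => Set.Ioi_subset_Ioi h

lemma integrableOn_const_div_prod_rpow (hα : 1 < α) {t : ℝ} (ht : 0 < t) (C : ℝ) :
    IntegrableOn (fun x : ι → ℝ => C / (∏ i, x i) ^ α) (orthant ι t) := by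
  have h : IntegrableOn (fun x : ι → ℝ => ∏ i, (x i) ^ (-α)) (orthant ι t) := by
    rw [IntegrableOn, volume_pi, Measure.restrict_pi_pi]
    exact Integrable.fintype_prod (f := fun _ : ι => fun u : ℝ => u ^ (-α))
      fun _ => integrableOn_Ioi_rpow_of_lt (by linarith) ht
  refine IntegrableOn.congr_fun (h.const_mul C) (fun x hx => ?_) (measurableSet_orthant t)
  have hx' : ∀ i, 0 ≤ x i := fun i => (ht.trans (mem_orthant.1 hx i)).le
  rw [Real.finsetProd_rpow _ _ (fun i _ => hx' i),
    Real.rpow_neg (Finset.prod_nonneg fun i _ => hx' i), div_eq_mul_inv]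

/-- Almost every point avoids a given value in all its coordinates. -/
lemma ae_forall_ne (t : ℝ) : ∀ᵐ x : ι → ℝ, ∀ i, x i ≠ t := by
  rw [ae_all_iff]
  intro i
  rw [ae_iff]
  simpa [volume_pi] using Measure.pi_hyperplane (fun _ : ι => (volume : Measure ℝ)) i t

/-- Almost every point has pairwise distinct coordinates. -/
lemma ae_injective : ∀ᵐ x : ι → ℝ, Function.Injective x := by
  classical
  have h : ∀ i j : ι, i ≠ j → ∀ᵐ x : ι → ℝ, x i ≠ x j := by
    intro i j hij
    rw [ae_iff]
    let S : Submodule ℝ (ι → ℝ) :=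
      LinearMap.ker (LinearMap.proj (R := ℝ) (φ := fun _ : ι => ℝ) i - LinearMap.proj j)
    have hS : S ≠ ⊤ := by
      intro h
      have : Pi.single i (1 : ℝ) ∈ S := h ▸ Submodule.mem_top
      simp [S, hij.symm] at this
    convert Measure.addHaar_submodule volume S hS using 2
    ext x
    simp [S, sub_eq_zero]
  have h' : ∀ᵐ x : ι → ℝ, ∀ i j, i ≠ j → x i ≠ x j := by
    simp only [ae_all_iff]
    exact h
  filter_upwards [h'] with x hx i j hij
  by_contra hne
  exact hx i j hne hij

namespace DominatedFamily

lemma continuousOn_apply (hf : DominatedFamily α f) {t : ℝ} (ht : 0 < t) :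
    ContinuousOn (f t) (orthant ι 0) :=
  hf.continuousOn.comp (f := fun x => (t, x)) (by fun_prop) fun _ hx => ⟨ht, hx⟩

lemma continuousAt_param (hf : DominatedFamily α f) {t : ℝ} (ht : 0 < t) {x : ι → ℝ}
    (hx : x ∈ orthant ι 0) : ContinuousAt (fun s => f s x) t := by
  have h := hf.continuousOn.continuousAt
    ((isOpen_Ioi.prod (isOpen_orthant 0)).mem_nhds (show (t, x) ∈ _ from ⟨ht, hx⟩))
  exact h.comp (f := fun s => (s, x)) (by fun_prop)

lemma aestronglyMeasurable (hf : DominatedFamily α f) {t s : ℝ} (ht : 0 < t) (hs : 0 ≤ s) :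
    AEStronglyMeasurable (f t) (volume.restrict (orthant ι s)) :=
  ((hf.continuousOn_apply ht).mono (orthant_mono hs)).aestronglyMeasurable
    (measurableSet_orthant s)

lemma integrableOn (hα : 1 < α) (hf : DominatedFamily α f) {t : ℝ} (ht : 0 < t) :
    IntegrableOn (f t) (orthant ι t) := by
  obtain ⟨C, hC⟩ := hf.bound t ht
  refine (integrableOn_const_div_prod_rpow hα ht C).mono' (hf.aestronglyMeasurable ht ht.le) ?_
  filter_upwards [ae_restrict_mem (measurableSet_orthant t)] with x hx
  exact hC t x le_rfl fun i => (mem_orthant.1 hx i).le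

lemma norm_indicator_le (hf : DominatedFamily α f) {a : ℝ} (ha : 0 < a) :
    ∃ C, ∀ t, a ≤ t → ∀ x, ‖(orthant ι t).indicator (f t) x‖ ≤
      (orthant ι a).indicator (fun x => C / (∏ i, x i) ^ α) x := by
  obtain ⟨C, hC⟩ := hf.bound a ha
  refine ⟨C, fun t hat x => ?_⟩
  by_cases hx : x ∈ orthant ι t
  · have hx' := orthant_mono hat hx
    rw [Set.indicator_of_mem hx, Set.indicator_of_mem hx']
    exact hC t x hat fun i => (mem_orthant.1 hx' i).le
  · rw [Set.indicator_of_notMem hx, norm_zero]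
    exact Set.indicator_nonneg (fun y hy =>
      (abs_nonneg (f a y)).trans (hC a y le_rfl fun i => (mem_orthant.1 hy i).le)) x

/-- The integral over the moving orthant `(t, ∞)^ι` depends continuously on `t`. -/
lemma continuousOn_integral (hα : 1 < α) (hf : DominatedFamily α f) :
    ContinuousOn (fun t => ∫ x in orthant ι t, f t x) (Set.Ioi 0) := by
  intro t (ht : 0 < t)
  apply ContinuousAt.continuousWithinAt
  simp_rw [← integral_indicator (measurableSet_orthant (ι := ι) _)]
  have ha : 0 < t / 2 := by linarith
  obtain ⟨C, hC⟩ := hf.norm_indicator_le ha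
  have hev : ∀ᶠ s in nhds t, t / 2 ≤ s := Ici_mem_nhds (by linarith)
  refine continuousAt_of_dominated
    (bound := (orthant ι (t / 2)).indicator fun x => C / (∏ i, x i) ^ α) ?_ ?_ ?_ ?_
  · filter_upwards [hev] with s hs
    exact (aestronglyMeasurable_indicator_iff (measurableSet_orthant s)).2
      (hf.aestronglyMeasurable (by linarith) (by linarith))
  · filter_upwards [hev] with s hs
    exact ae_of_all _ (hC s hs)
  · exact (integrableOn_const_div_prod_rpow hα ha C).integrable_indicator (measurableSet_orthant _)
  · filter_upwards [ae_forall_ne t] with x hx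
    by_cases hxt : x ∈ orthant ι t
    · refine (hf.continuousAt_param ht (orthant_mono ht.le hxt)).congr ?_
      have : ∀ᶠ s in nhds t, ∀ i, s < x i :=
        Filter.eventually_all.2 fun i => Iio_mem_nhds (mem_orthant.1 hxt i)
      filter_upwards [this] with s hs
      rw [Set.indicator_of_mem (mem_orthant.2 hs)]
    · obtain ⟨i, hi⟩ : ∃ i, x i ≤ t := by simpa [mem_orthant] using hxt
      refine (continuousAt_const (y := (0 : ℝ))).congr ?_
      filter_upwards [Ioi_mem_nhds (lt_of_le_of_ne hi (hx i))] with s hs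
      exact (Set.indicator_of_notMem
        (fun h => absurd (mem_orthant.1 h i) (not_lt.2 (le_of_lt hs))) _).symm

/-- Joint integrability of the family over `{(s, x) | a < s ≤ b, x ∈ (s, ∞)^ι}`. -/
lemma integrable_prod (hα : 1 < α) (hf : DominatedFamily α f) {a : ℝ} (ha : 0 < a) (b : ℝ) :
    Integrable (fun p : ℝ × (ι → ℝ) => (orthant ι p.1).indicator (f p.1) p.2)
      ((volume.restrict (Set.Ioc a b)).prod volume) := by
  obtain ⟨C, hC⟩ := hf.norm_indicator_le ha
  let U : Set (ℝ × (ι → ℝ)) := {p | 0 < p.1 ∧ ∀ i, p.1 < p.2 i}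
  have hU : IsOpen U := by
    simp only [U, Set.ofPred_and, Set.ofPred_forall]
    exact (isOpen_lt (by fun_prop) (by fun_prop)).inter
      (isOpen_iInter_of_finite fun i => isOpen_lt (by fun_prop) (by fun_prop))
  have hmem : ∀ᵐ p : ℝ × (ι → ℝ) ∂((volume.restrict (Set.Ioc a b)).prod volume), a < p.1 :=
    Measure.quasiMeasurePreserving_fst.ae
      ((ae_restrict_mem measurableSet_Ioc).mono fun _ h => h.1)
  refine (((integrableOn_const_div_prod_rpow hα ha C).integrable_indicator
    (measurableSet_orthant a)).comp_snd (volume.restrict (Set.Ioc a b))).mono' ?_ ?_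
  · have h1 : AEStronglyMeasurable (U.indicator fun p : ℝ × (ι → ℝ) => f p.1 p.2)
        ((volume.restrict (Set.Ioc a b)).prod volume) :=
      (aestronglyMeasurable_indicator_iff hU.measurableSet).2
        ((hf.continuousOn.mono fun p hp => ⟨hp.1, mem_orthant.2 fun i => hp.1.trans (hp.2 i)⟩
          ).aestronglyMeasurable hU.measurableSet)
    refine h1.congr ?_
    filter_upwards [hmem] with p hp
    simp [Set.indicator, U, ha.trans hp]
  · filter_upwards [hmem] with p hp
    exact hC p.1 hp.le p.2

end DominatedFamily

end

section

variable {ι : Type*} [DecidableEq ι] {α : ℝ} {f f' : ℝ → (ι → ℝ) → ℝ}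

/-- The restriction of a family to the face `x l = t`. -/
def faceFamily (f : ℝ → (ι → ℝ) → ℝ) (l : ι) (t : ℝ) (y : {i // i ≠ l} → ℝ) : ℝ :=
  f t fun i => if hi : i = l then t else y ⟨i, hi⟩

/-- The value `f (x l) x` on the set where `x l ∈ (a, b]` is the strict minimum of the
coordinates of `x`, and zero elsewhere. -/
def slab (f : ℝ → (ι → ℝ) → ℝ) (a b : ℝ) (l : ι) (x : ι → ℝ) : ℝ :=
  (Set.Ioc a b).indicator
    (fun u => (orthant {i // i ≠ l} u).indicator (faceFamily f l u)
      fun i : {i // i ≠ l} => x i) (x l)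

lemma slab_of_mem {a b : ℝ} {l : ι} {x : ι → ℝ} (h : x l ∈ Set.Ioc a b)
    (hmin : ∀ i, i ≠ l → x l < x i) : slab f a b l x = f (x l) x := by
  rw [slab, Set.indicator_of_mem h, Set.indicator_of_mem
    (mem_orthant.2 fun i : {i // i ≠ l} => hmin i.1 i.2), faceFamily]
  congr 1
  ext i
  split_ifs with hi
  · rw [hi]
  · rfl

lemma slab_of_notMem {a b : ℝ} {l : ι} {x : ι → ℝ}
    (h : ¬ (x l ∈ Set.Ioc a b ∧ ∀ i, i ≠ l → x l < x i)) : slab f a b l x = 0 := by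
  by_cases hl : x l ∈ Set.Ioc a b
  · rw [slab, Set.indicator_of_mem hl, Set.indicator_of_notMem]
    exact fun hx => h ⟨hl, fun i hi => mem_orthant.1 hx ⟨i, hi⟩⟩
  · rw [slab, Set.indicator_of_notMem hl]

/-- Separating the coordinate `l` from the remaining ones. -/
def splitCoord (l : ι) : (ι → ℝ) ≃ᵐ ℝ × ({i // i ≠ l} → ℝ) :=
  (MeasurableEquiv.piEquivPiSubtypeProd (fun _ => ℝ) (· = l)).trans
    ((MeasurableEquiv.funUnique {i // i = l} ℝ).prodCongr (MeasurableEquiv.refl _))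

lemma splitCoord_apply (l : ι) (x : ι → ℝ) :
    splitCoord l x = (x l, fun i : {i // i ≠ l} => x i) := rfl

variable [Fintype ι]

lemma measurePreserving_splitCoord (l : ι) :
    MeasurePreserving (splitCoord l) volume (volume.prod volume) := by
  have h1 := volume_preserving_piEquivPiSubtypeProd (fun _ : ι => ℝ) (· = l)
  have h2 : MeasurePreserving (MeasurableEquiv.funUnique {i // i = l} ℝ)
      (@volume _ (@MeasureSpace.pi _ (Subtype.fintype (· = l)) _ _)) volume := by
    convert volume_preserving_funUnique {i // i = l} ℝ
  exact (h2.prod (MeasurePreserving.id (volume : Measure ({i // i ≠ l} → ℝ)))).comp h1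

lemma DominatedFamily.face (hα : 0 ≤ α) (hf : DominatedFamily α f) (l : ι) :
    DominatedFamily α (faceFamily f l) where
  continuousOn := by
    refine hf.continuousOn.comp (f := fun p : ℝ × ({i // i ≠ l} → ℝ) =>
      (p.1, fun i => if hi : i = l then p.1 else p.2 ⟨i, hi⟩)) ?_ ?_
    · refine (continuous_fst.prodMk (continuous_pi fun i => ?_)).continuousOn
      by_cases hi : i = l
      · simpa [hi] using continuous_fst
      · simp only [hi, dite_false]
        fun_prop
    · rintro ⟨t, y⟩ ⟨ht, hy⟩
      refine ⟨ht, mem_orthant.2 fun i => ?_⟩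
      by_cases hi : i = l
      · simpa [hi] using ht
      · simpa [hi] using mem_orthant.1 hy ⟨i, hi⟩
  bound := by
    intro x₀ hx₀
    obtain ⟨C, hC⟩ := hf.bound x₀ hx₀
    have hC0 : 0 ≤ C := by
      by_contra hneg
      have h1 := (abs_nonneg _).trans (hC x₀ (fun _ => x₀) le_rfl fun _ => le_rfl)
      have h2 : 0 < (∏ _i : ι, x₀) ^ α := Real.rpow_pos_of_pos (Finset.prod_pos fun _ _ => hx₀) _
      exact absurd h1 (not_le.2 (div_neg_of_neg_of_pos (not_le.1 hneg) h2))
    refine ⟨C / x₀ ^ α, fun t y ht hy => ?_⟩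
    have hprod : ∏ i, (if hi : i = l then t else y ⟨i, hi⟩) = t * ∏ i, y i := by
      rw [Fintype.prod_eq_mul_prod_subtype_ne _ l]
      congr 1
      · simp
      · exact Finset.prod_congr rfl fun i _ => dif_neg i.2
    have ht0 : 0 < t := hx₀.trans_le ht
    have hy0 : 0 < ∏ i, y i := Finset.prod_pos fun i _ => hx₀.trans_le (hy i)
    have h := hC t (fun i => if hi : i = l then t else y ⟨i, hi⟩) ht fun i => by
      split_ifs with hi
      · exact ht
      · exact hy _
    rw [hprod, Real.mul_rpow ht0.le hy0.le] at h
    rw [div_div]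
    refine h.trans ?_
    gcongr

namespace DominatedFamily

lemma integrable_slab_and_integral (hα : 1 < α) (hf : DominatedFamily α f) {a : ℝ} (ha : 0 < a)
    (b : ℝ) (l : ι) : Integrable (slab f a b l) ∧
      ∫ x, slab f a b l x = ∫ u in Set.Ioc a b, ∫ y in orthant {i // i ≠ l} u, faceFamily f l u y := by
  have hα0 : 0 ≤ α := by linarith
  let g : ℝ × ({i // i ≠ l} → ℝ) → ℝ := fun p =>
    (orthant {i // i ≠ l} p.1).indicator (faceFamily f l p.1) p.2
  let S : Set (ℝ × ({i // i ≠ l} → ℝ)) := Set.Ioc a b ×ˢ Set.univ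
  have hS : MeasurableSet S := measurableSet_Ioc.prod MeasurableSet.univ
  have hg := (hf.face hα0 l).integrable_prod hα ha b
  have hmeas : (volume.restrict (Set.Ioc a b)).prod (volume : Measure ({i // i ≠ l} → ℝ)) =
      (volume.prod volume).restrict S := by
    rw [← Measure.prod_restrict, Measure.restrict_univ]
  have hcomp : slab f a b l = S.indicator g ∘ splitCoord l := by
    ext x
    rw [Function.comp_apply, splitCoord_apply]
    simp [slab, S, g, Set.indicator]
  constructor
  · rw [hcomp, (measurePreserving_splitCoord l).integrable_comp_emb
      (splitCoord l).measurableEmbedding, integrable_indicator_iff hS, IntegrableOn, ← hmeas]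
    exact hg
  · calc ∫ x, slab f a b l x = ∫ x, S.indicator g (splitCoord l x) := by rw [hcomp]; rfl
      _ = ∫ p, S.indicator g p ∂(volume.prod volume) :=
        (measurePreserving_splitCoord l).integral_comp' _
      _ = ∫ p, g p ∂((volume.restrict (Set.Ioc a b)).prod volume) := by
        rw [integral_indicator hS, hmeas]
      _ = _ := by
        rw [integral_prod _ hg]
        exact integral_congr_ae (ae_of_all _ fun u => integral_indicator (measurableSet_orthant u))

/-- For a point `x` with distinct coordinates, the increment of `s ↦ 1_{x ∈ (s, ∞)^ι} f(s, x)`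
on `[a, b]` is the integral of its derivative plus the jump at the smallest coordinate. -/
lemma indicator_sub_indicator (hf' : DominatedFamily α f')
    (hderiv : ∀ s, 0 < s → ∀ x ∈ orthant ι 0, HasDerivAt (fun s => f s x) (f' s x) s)
    {a b : ℝ} (ha : 0 < a) (hab : a ≤ b) {x : ι → ℝ} (hx : Function.Injective x) :
    (orthant ι b).indicator (f b) x - (orthant ι a).indicator (f a) x =
      (∫ s in Set.Ioc a b, (orthant ι s).indicator (f' s) x) - ∑ l, slab f a b l x := by
  have ftc : ∀ c, a ≤ c → x ∈ orthant ι 0 → ∫ s in Set.Ioc a c, f' s x = f c x - f a x := by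
    intro c hac hx0
    have hpos : ∀ s ∈ Set.uIcc a c, 0 < s := fun s hs => by
      rw [Set.uIcc_of_le hac] at hs
      exact ha.trans_le hs.1
    rw [← intervalIntegral.integral_of_le hac]
    refine intervalIntegral.integral_eq_sub_of_hasDerivAt (f := fun s => f s x)
      (fun s hs => hderiv s (hpos s hs) x hx0) (ContinuousOn.intervalIntegrable fun s hs => ?_)
    exact (hf'.continuousAt_param (hpos s hs) hx0).continuousWithinAt
  by_cases hxa : x ∈ orthant ι a
  · have hx0 := orthant_mono ha.le hxa
    by_cases hxb : x ∈ orthant ι b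
    · have hsum : ∑ l, slab f a b l x = 0 := Finset.sum_eq_zero fun l _ =>
        slab_of_notMem fun h => absurd h.1.2 (not_le.2 (mem_orthant.1 hxb l))
      rw [hsum, sub_zero, Set.indicator_of_mem hxa, Set.indicator_of_mem hxb, ← ftc b hab hx0]
      exact setIntegral_congr_fun measurableSet_Ioc fun s hs =>
        (Set.indicator_of_mem (orthant_mono hs.2 hxb) _).symm
    · obtain ⟨j, hj⟩ : ∃ i, x i ≤ b := by simpa [mem_orthant] using hxb
      obtain ⟨l, -, hl⟩ := Finset.exists_min_image Finset.univ x ⟨j, Finset.mem_univ j⟩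
      have hmin : ∀ i, i ≠ l → x l < x i := fun i hi =>
        lt_of_le_of_ne (hl i (Finset.mem_univ i)) fun h => hi (hx h).symm
      have hla : a < x l := mem_orthant.1 hxa l
      have hlb : x l ≤ b := (hl j (Finset.mem_univ j)).trans hj
      have hsum : ∑ l, slab f a b l x = f (x l) x := by
        rw [Finset.sum_eq_single l, slab_of_mem ⟨hla, hlb⟩ hmin]
        · exact fun i _ hi => slab_of_notMem fun h =>
            absurd (h.2 l hi.symm) (not_lt.2 (hl i (Finset.mem_univ i)))
        · simp
      have hint : ∫ s in Set.Ioc a b, (orthant ι s).indicator (f' s) x =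
          ∫ s in Set.Ioc a (x l), f' s x := by
        have : ∀ s, (orthant ι s).indicator (f' s) x =
            (Set.Iio (x l)).indicator (fun s => f' s x) s := by
          intro s
          have hiff : x ∈ orthant ι s ↔ s ∈ Set.Iio (x l) :=
            ⟨fun h => mem_orthant.1 h l,
              fun h => mem_orthant.2 fun i => lt_of_lt_of_le h (hl i (Finset.mem_univ i))⟩
          by_cases hs : s ∈ Set.Iio (x l)
          · rw [Set.indicator_of_mem hs, Set.indicator_of_mem (hiff.2 hs)]
          · rw [Set.indicator_of_notMem hs, Set.indicator_of_notMem fun h => hs (hiff.1 h)]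
        simp_rw [this]
        rw [setIntegral_indicator measurableSet_Iio, integral_Ioc_eq_integral_Ioo]
        congr 2
        ext s
        simp only [Set.mem_inter_iff, Set.mem_Ioc, Set.mem_Iio, Set.mem_Ioo]
        exact ⟨fun h => ⟨h.1.1, h.2⟩, fun h => ⟨⟨h.1, h.2.le.trans hlb⟩, h.2⟩⟩
      rw [hsum, hint, ftc _ hla.le hx0, Set.indicator_of_mem hxa, Set.indicator_of_notMem hxb]
      ring
  · have hxs : ∀ s, a ≤ s → x ∉ orthant ι s := fun s hs h => hxa (orthant_mono hs h)
    have hsum : ∑ l, slab f a b l x = 0 := Finset.sum_eq_zero fun l _ =>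
      slab_of_notMem fun h => hxa (mem_orthant.2 fun i => by
        rcases eq_or_ne i l with rfl | hi
        · exact h.1.1
        · exact h.1.1.trans (h.2 i hi))
    have hint : ∫ s in Set.Ioc a b, (orthant ι s).indicator (f' s) x = 0 :=
      setIntegral_eq_zero_of_forall_eq_zero fun s hs =>
        Set.indicator_of_notMem (hxs s hs.1.le) _
    rw [hsum, hint, Set.indicator_of_notMem (hxs b hab), Set.indicator_of_notMem hxa]

lemma continuousOn_integral_sub_sum_face (hα : 1 < α) (hf : DominatedFamily α f)
    (hf' : DominatedFamily α f') :
    ContinuousOn (fun t => (∫ x in orthant ι t, f' t x) -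
      ∑ l, ∫ y in orthant {i // i ≠ l} t, faceFamily f l t y) (Set.Ioi 0) :=
  have hα0 : 0 ≤ α := by linarith
  (hf'.continuousOn_integral hα).sub
    (continuousOn_finsetSum _ fun l _ => (hf.face hα0 l).continuousOn_integral hα)

/-- The increment of `t ↦ ∫ x in (t, ∞)^ι, f t x` is the integral of its derivative. -/
lemma integral_sub_integral (hα : 1 < α) (hf : DominatedFamily α f) (hf' : DominatedFamily α f')
    (hderiv : ∀ s, 0 < s → ∀ x ∈ orthant ι 0, HasDerivAt (fun s => f s x) (f' s x) s)
    {a b : ℝ} (ha : 0 < a) (hab : a ≤ b) :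
    (∫ x in orthant ι b, f b x) - ∫ x in orthant ι a, f a x =
      ∫ s in a..b, ((∫ x in orthant ι s, f' s x) -
        ∑ l, ∫ y in orthant {i // i ≠ l} s, faceFamily f l s y) := by
  have hα0 : 0 ≤ α := by linarith
  have hI : ∀ g : ℝ → ℝ, ContinuousOn g (Set.Ioi 0) → IntegrableOn g (Set.Ioc a b) := fun g hg =>
    ((hg.mono fun s hs => ha.trans_le hs.1).integrableOn_Icc).mono_set Set.Ioc_subset_Icc_self
  have hind : ∀ t, 0 < t → Integrable ((orthant ι t).indicator (f t)) := fun t ht =>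
    (hf.integrableOn hα ht).integrable_indicator (measurableSet_orthant t)
  have hslab := hf.integrable_slab_and_integral hα ha b
  have hprod := hf'.integrable_prod hα ha b
  have hprod_left : Integrable fun x : ι → ℝ =>
      ∫ s in Set.Ioc a b, (orthant ι s).indicator (f' s) x := hprod.swap.integral_prod_left
  rw [intervalIntegral.integral_of_le hab, integral_sub (hI _ (hf'.continuousOn_integral hα))
    (integrable_finsetSum _ fun l _ => hI _ ((hf.face hα0 l).continuousOn_integral hα)),
    integral_finsetSum _ fun l _ => hI _ ((hf.face hα0 l).continuousOn_integral hα),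
    ← integral_indicator (measurableSet_orthant b), ← integral_indicator (measurableSet_orthant a),
    ← integral_sub (hind b (ha.trans_le hab)) (hind a ha),
    integral_congr_ae ((ae_injective (ι := ι)).mono fun x hx =>
      indicator_sub_indicator hf' hderiv ha hab hx),
    integral_sub hprod_left (integrable_finsetSum _ fun l _ => (hslab l).1),
    integral_finsetSum _ fun l _ => (hslab l).1, ← integral_integral_swap hprod]
  simp_rw [fun l => (hslab l).2, integral_indicator (measurableSet_orthant (ι := ι) _)]

/-- Leibniz rule for the integral of a dominated family over the moving orthant `(t, ∞)^ι`. -/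
lemma hasDerivAt_integral (hα : 1 < α) (hf : DominatedFamily α f) (hf' : DominatedFamily α f')
    (hderiv : ∀ s, 0 < s → ∀ x ∈ orthant ι 0, HasDerivAt (fun s => f s x) (f' s x) s)
    {t : ℝ} (ht : 0 < t) :
    HasDerivAt (fun s => ∫ x in orthant ι s, f s x) ((∫ x in orthant ι t, f' t x) -
        ∑ l, ∫ y in orthant {i // i ≠ l} t, faceFamily f l t y) t := by
  have hcont := hf.continuousOn_integral_sub_sum_face hα hf'
  have ha : 0 < t / 2 := by linarith
  have hFTC := intervalIntegral.integral_hasDerivAt_right (a := t / 2) (b := t)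
    (ContinuousOn.intervalIntegrable (hcont.mono fun s hs => by
      rw [Set.uIcc_of_le (by linarith)] at hs
      exact ha.trans_le hs.1))
    (hcont.stronglyMeasurableAtFilter isOpen_Ioi t ht) (hcont.continuousAt (Ioi_mem_nhds ht))
  refine (hFTC.const_add (∫ x in orthant ι (t / 2), f (t / 2) x)).congr_of_eventuallyEq ?_
  filter_upwards [Ioi_mem_nhds (show t / 2 < t by linarith)] with s hs
  rw [← hf.integral_sub_integral hα hf' hderiv ha (le_of_lt hs)]
  ring

end DominatedFamily

end

/-- Differentiation of parameter-dependent integrals with moving domain: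
if `F : (0,∞)^{k+1} → ℝ` is `C¹` and `|F| + |∂F/∂t| ≤ C(x₀)/(x₁⋯x_k)^α` for some `α > 1`,
then all integrals defining `H₀` and `H₁` are absolutely convergent, and `H₀` is
continuously differentiable on `(0,∞)` with derivative `H₁`. -/
theorem deriv_of_moving_domain_integral (k : ℕ) (hk : 1 ≤ k) (F : ℝ → (Fin k → ℝ) → ℝ)
    (hF : ContDiffOn ℝ 1 (fun p : ℝ × (Fin k → ℝ) => F p.1 p.2)
      (Set.Ioi 0 ×ˢ Set.univ.pi fun _ => Set.Ioi 0))
    (α : ℝ) (hα : 1 < α)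
    (hbound : ∀ x₀ : ℝ, 0 < x₀ → ∃ C : ℝ, ∀ t : ℝ, ∀ x : Fin k → ℝ,
      x₀ ≤ t → (∀ i, x₀ ≤ x i) →
      |F t x| + |deriv (fun t' => F t' x) t| ≤ C / (∏ i, x i) ^ α) :
    (∀ t : ℝ, 0 < t →
      MeasureTheory.IntegrableOn (F t) (Set.univ.pi fun _ : Fin k => Set.Ioi t) ∧
      MeasureTheory.IntegrableOn (fun x => deriv (fun t' => F t' x) t)
        (Set.univ.pi fun _ : Fin k => Set.Ioi t) ∧
      ∀ l : Fin k,
        MeasureTheory.IntegrableOn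
          (fun y : { i : Fin k // i ≠ l } → ℝ =>
            F t fun i => if hi : i = l then t else y ⟨i, hi⟩)
          (Set.univ.pi fun _ => Set.Ioi t)) ∧
    (∀ t : ℝ, 0 < t → HasDerivAt (H0 k F) (H1 k F t) t) ∧
    ContinuousOn (H1 k F) (Set.Ioi 0) := by
  let f' : ℝ → (Fin k → ℝ) → ℝ := fun t x => deriv (fun t' => F t' x) t
  have hopen : IsOpen (Set.Ioi (0 : ℝ) ×ˢ orthant (Fin k) 0) := isOpen_Ioi.prod (isOpen_orthant 0)
  have hline : ∀ s, 0 < s → ∀ x ∈ orthant (Fin k) 0, HasDerivAt (fun s => F s x)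
      (fderiv ℝ (fun p : ℝ × (Fin k → ℝ) => F p.1 p.2) (s, x) (1, 0)) s := by
    intro s hs x hx
    have h := ((hF.contDiffAt (hopen.mem_nhds (show (s, x) ∈ _ from ⟨hs, hx⟩))).differentiableAt
      one_ne_zero).hasFDerivAt
    exact h.comp_hasDerivAt s ((hasDerivAt_id s).prodMk (hasDerivAt_const s x))
  have hderiv : ∀ s, 0 < s → ∀ x ∈ orthant (Fin k) 0, HasDerivAt (fun s => F s x) (f' s x) s :=
    fun s hs x hx => (hline s hs x hx).differentiableAt.hasDerivAt
  have hf : DominatedFamily α F := by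
    refine ⟨hF.continuousOn, fun x₀ hx₀ => (hbound x₀ hx₀).imp fun C hC t x ht hx => ?_⟩
    exact (le_add_of_nonneg_right (abs_nonneg _)).trans (hC t x ht hx)
  have hf' : DominatedFamily α f' := by
    refine ⟨?_, fun x₀ hx₀ => (hbound x₀ hx₀).imp fun C hC t x ht hx => ?_⟩
    · refine ((hF.continuousOn_fderiv_of_isOpen hopen le_rfl).clm_apply
        (continuousOn_const (c := ((1 : ℝ), (0 : Fin k → ℝ))))).congr ?_
      rintro ⟨s, x⟩ ⟨hs, hx⟩
      exact (hline s hs x hx).deriv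
    · exact (le_add_of_nonneg_left (abs_nonneg _)).trans (hC t x ht hx)
  exact ⟨fun t ht => ⟨hf.integrableOn hα ht, hf'.integrableOn hα ht,
      fun l => (hf.face (by linarith) l).integrableOn hα ht⟩,
    fun t ht => hf.hasDerivAt_integral hα hf' hderiv ht,
    hf.continuousOn_integral_sub_sum_face hα hf'⟩
end
end
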